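/- For all integers n ≥ m ≥ 0, the identity Z_l(n,m) = Z_r(n,m) holds; that is, -(1/3) Σ_{ν=n-m+1}^∞ (d/dt R_{n,m}(t))|_{t=ν} = (1/6) Σ_{ν=1}^∞ (d²/dt² R̃_{n,m}(t))|_{t=ν}. -/

import Mathlib

open scoped BigOperators

/-- The Pochhammer symbol `(x)_k = x (x+1) ⋯ (x+k-1)` for a real `x`. -/
noncomputable def poch (x : ℝ) (k : ℕ) : ℝ := ∏ i ∈ Finset.range k, (x + i)

/-- The rational function `R_{n,m}(t)` from the paper. -/
noncomputable def R (n m : ℕ) (t : ℝ) : ℝ :=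
  (-1 : ℝ) ^ m * (t + n / 2) * (poch (t - n) m / m.factorial) *
    (poch (t - 2 * n + m) (2 * n - m) / (2 * n - m).factorial) *
    (poch (t + n + 1) n / poch t (n + 1)) *
    (poch (t + n + 1) (2 * n - m) / poch t (2 * n - m + 1)) *
    ((n.factorial : ℝ) / poch t (n + 1)) ^ 2

/-- The rational function `R̃_{n,m}(t)` from the paper. -/
noncomputable def Rtilde (n m : ℕ) (t : ℝ) : ℝ :=
  ((n.factorial : ℝ) * poch (t - n) (2 * n - m) / (poch t (n + 1) * poch t (2 * n - m + 1))) *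
    ∑ j ∈ Finset.range (n + 1),
      (n.choose j : ℝ) ^ 2 * ((2 * n - m + j).choose n : ℝ) * poch (t - j) n / n.factorial

/-- `Z_l(n,m) = -(1/3) Σ_{ν=n-m+1}^∞ (d/dt R_{n,m}(t))|_{t=ν}`. -/
noncomputable def Zl (n m : ℕ) : ℝ :=
  -(1 / 3) * ∑' ν : ℕ, deriv (R n m) ((n : ℝ) - m + 1 + ν)

/-- `Z_r(n,m) = (1/6) Σ_{ν=1}^∞ (d²/dt² R̃_{n,m}(t))|_{t=ν}`. -/
noncomputable def Zr (n m : ℕ) : ℝ :=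
  (1 / 6) * ∑' ν : ℕ, deriv (deriv (Rtilde n m)) (1 + (ν : ℝ))

/-- `U_k(n) = Σ_{i=0}^n C(4i,2i) / ((2i+1)^k C(2i,i)^8)`. -/
noncomputable def U (k n : ℕ) : ℝ :=
  ∑ i ∈ Finset.range (n + 1),
    ((4 * i).choose (2 * i) : ℝ) / ((2 * i + 1) ^ k * ((2 * i).choose i : ℝ) ^ 8)

/-- The harmonic number `S₁(N) = Σ_{i=1}^N 1/i`. -/
noncomputable def S1 (N : ℕ) : ℝ := ∑ i ∈ Finset.range N, (1 : ℝ) / (i + 1)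

open Filter Topology Polynomial

/-- The coefficient at `(n, m)` in the diagonal recurrence, with `N = 2 * n - m`. -/
noncomputable def diagC0 (n N : ℝ) : ℝ :=
  2 * n^4 + 7 * n^3 * N + 8 * n^3 + 12 * n^2 * N^2 + 21 * n^2 * N + 12 * n^2 + 12 * n * N^3 +
    24 * n * N^2 + 21 * n * N + 8 * n + 6 * N^4 + 12 * N^3 + 12 * N^2 + 7 * N + 2

/-- The coefficient at `(n, m + 1)` in the diagonal recurrence, with `N = 2 * n - m`. -/
noncomputable def diagC1 (n N : ℝ) : ℝ :=
  N^3 * (2 * n + N + 1) * (-6)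

/-- The coefficient at `(n + 1, m + 2)` in the diagonal recurrence, with `N = 2 * n - m`. -/
noncomputable def diagC2 (n N : ℝ) : ℝ :=
  (n + 1)^3 * (2 * n + 2 - N)

/-- The numerator of the part of the certificate telescoping in `t`, for the diagonal recurrence. -/
noncomputable def diagP1 (n N t j : ℝ) : ℝ :=
  (N * (n + 1) * (-8 * n^4 - 4 * n^3 * N - 24 * n^3 + 12 * n^2 * N^2 - 4 * n^2 * N -
    28 * n^2 + 6 * n * N^3 + 24 * n * N^2 - 2 * n * N - 16 * n + 6 * N^2 - 2 * N - 4)) +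
  ((-4 * n^5 * N - 8 * n^5 - 2 * n^4 * N^2 - 4 * n^4 * N - 32 * n^4 + 6 * n^3 * N^3 +
    18 * n^3 * N^2 + 16 * n^3 * N - 52 * n^3 + 6 * n^2 * N^4 + 6 * n^2 * N^3 + 40 * n^2 * N^2 +
    30 * n^2 * N - 44 * n^2 - 6 * n * N^4 - 24 * n * N^3 + 24 * n * N^2 + 16 * n * N - 20 * n -
    12 * N^3 + 4 * N^2 + 2 * N - 4)) * j +
  ((4 * n^4 * N + 8 * n^4 + 2 * n^3 * N^2 + 12 * n^3 * N + 28 * n^3 - 6 * n^2 * N^3 -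
    14 * n^2 * N^2 + 10 * n^2 * N + 36 * n^2 - 6 * n * N^4 - 18 * n * N^3 - 28 * n * N^2 +
    20 * n - 12 * N^2 - 2 * N + 4)) * j^2 +
  (N * (n + 1) * (4 * n^4 + 2 * n^3 * N + 12 * n^3 - 6 * n^2 * N^2 + 4 * n^2 * N + 16 * n^2 -
    6 * n * N^3 - 12 * n * N^2 + 8 * n * N + 12 * n + 6 * N + 4)) * t +
  ((4 * n^5 - 6 * n^4 * N + 16 * n^4 - 10 * n^3 * N^2 - 18 * n^3 * N + 28 * n^3 +
    6 * n^2 * N^3 - 16 * n^2 * N^2 - 16 * n^2 * N + 28 * n^2 + 12 * n * N^4 + 24 * n * N^3 -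
    8 * n * N^2 - 2 * n * N + 16 * n + 6 * N^3 - 2 * N^2 + 2 * N + 4)) * t * j +
  ((-4 * n^4 - 2 * n^3 * N - 16 * n^3 + 6 * n^2 * N^2 - 6 * n^2 * N - 24 * n^2 +
    6 * n * N^3 + 12 * n * N^2 - 6 * n * N - 16 * n + 6 * N^2 - 2 * N - 4)) * t * j^2

/-- The numerator of the part of the certificate telescoping in `j`, for the diagonal recurrence. -/
noncomputable def diagP2 (n N t j : ℝ) : ℝ :=
  (N * (n + 1 - N) * (n + 1)^3 * (-4 * n - 6 * N - 4)) +
  ((n + 1) * (4 * n^4 * N - 4 * n^4 + 2 * n^3 * N^2 + 12 * n^3 * N - 16 * n^3 -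
    6 * n^2 * N^3 - 3 * n^2 * N^2 + 12 * n^2 * N - 24 * n^2 - 6 * n * N^4 - 30 * n * N^3 -
    12 * n * N^2 + 4 * n * N - 16 * n - 24 * N^3 - 7 * N^2 - 4)) * j +
  ((n + 1) * (2 * n^3 + 3 * n^2 * N + 6 * n^2 + 6 * n * N^2 + 6 * n * N + 6 * n + 12 * N^3 +
    6 * N^2 + 3 * N + 2)) * j^2 +
  (N * (n + 1) * (-4 * n^4 - 2 * n^3 * N - 6 * n^3 + 6 * n^2 * N^2 + 17 * n^2 * N + 6 * n^2 +
    6 * n * N^3 + 24 * n * N^2 + 40 * n * N + 14 * n + 18 * N^2 + 21 * N + 6)) * t +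
  ((n + 1) * (4 * n^4 + 2 * n^3 * N + 18 * n^3 - 6 * n^2 * N^2 - 9 * n^2 * N + 30 * n^2 -
    6 * n * N^3 - 49 * n * N^2 - 24 * n * N + 22 * n - 18 * N^3 - 43 * N^2 - 13 * N +
    6)) * t * j +
  ((-2 * n^3 + 5 * n^2 * N - 6 * n^2 + 18 * n * N^2 + 10 * n * N - 6 * n + 6 * N^3 +
    18 * N^2 + 5 * N - 2)) * t * j^2 +
  (N * (-4 * n^4 - 2 * n^3 * N - 2 * n^3 + 6 * n^2 * N^2 + 19 * n^2 * N + 18 * n^2 +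
    6 * n * N^3 + 18 * n * N^2 + 44 * n * N + 26 * n + 12 * N^2 + 23 * N + 10)) * t^2 +
  ((-4 * n^4 - 2 * n^3 * N - 14 * n^3 + 6 * n^2 * N^2 - 11 * n^2 * N - 18 * n^2 +
    6 * n * N^3 - 6 * n * N^2 - 16 * n * N - 10 * n - 6 * N^3 - 12 * N^2 - 7 * N - 2)) * t^2 * j

/-- The coefficient at `(n, m)` in the row recurrence, with `N = 2 * n - m`. -/
noncomputable def rowC0 (n N : ℝ) : ℝ :=
  N^5 * (n + 1)

/-- The coefficient at `(n, m + 1)` in the row recurrence, with `N = 2 * n - m`. -/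
noncomputable def rowC1 (n N : ℝ) : ℝ :=
  (2 * N - 1) * (n + 1) * (2 * n^4 + 4 * n^3 + 2 * n^2 * N^2 - 2 * n^2 * N + 4 * n^2 +
    2 * n * N^2 - 2 * n * N + 2 * n - N^4 + 2 * N^3 - 2 * N^2 + N)

/-- The coefficient at `(n, m + 2)` in the row recurrence, with `N = 2 * n - m`. -/
noncomputable def rowC2 (n N : ℝ) : ℝ :=
  (N - 1)^3 * (n + 1) * (2 * n + 2 - N) * (2 * n + N) * (-1)

/-- The numerator of the part of the certificate telescoping in `t`, for the row recurrence. -/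
noncomputable def rowP1 (n N t j : ℝ) : ℝ :=
  ((N - 1) * (2 * n^5 * N - 4 * n^4 * N^2 + 6 * n^4 * N + 2 * n^3 * N^3 - 12 * n^3 * N^2 +
    11 * n^3 * N - 2 * n^3 + n^2 * N^3 - 12 * n^2 * N^2 + 9 * n^2 * N - 2 * n^2 + n * N^4 -
    4 * n * N^3 - n * N^2 + n * N + N^4 - 3 * N^3 + N^2)) +
  ((4 * n^5 * N - 2 * n^5 - 12 * n^4 * N^2 + 20 * n^4 * N - 6 * n^4 + 5 * n^3 * N^3 -
    26 * n^3 * N^2 + 24 * n^3 * N - 4 * n^3 - n^2 * N^4 + 4 * n^2 * N^3 - 21 * n^2 * N^2 +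
    16 * n^2 * N - 2 * n^2 + n * N^4 - 2 * n * N^3 - 9 * n * N^2 + 9 * n * N - 2 * n +
    2 * N^4 - 7 * N^3 + 5 * N^2 - N)) * j +
  ((-4 * n^4 * N + 2 * n^4 + 6 * n^3 * N^2 - 16 * n^3 * N + 6 * n^3 - n^2 * N^3 +
    4 * n^2 * N^2 - 12 * n^2 * N + 4 * n^2 + 2 * n * N^3 - 6 * n * N^2 + n * N - N^3)) * j^2 +
  ((N - 1) * (3 * n^3 * N^2 - 5 * n^3 * N + 2 * n^3 + n^2 * N^3 + 6 * n^2 * N^2 -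
    7 * n^2 * N + 2 * n^2 + 3 * n * N^3 - n * N + 2 * N^3 - N^2)) * t +
  ((n^2 * N^3 + 6 * n^2 * N^2 - 7 * n^2 * N + 2 * n^2 + n * N^3 + 6 * n * N^2 - 7 * n * N +
    2 * n + 4 * N^3 - 4 * N^2 + N)) * t * j

/-- The numerator of the part of the certificate telescoping in `j`, for the row recurrence. -/
noncomputable def rowP2 (n N t j : ℝ) : ℝ :=
  ((N - 1) * N * (n + 1 - N) * (n + 2 - N) * (n + 1) * (2 * n^2 + 2 * n + N)) +
  (N * (n + 1) * (2 * n^3 * N + 3 * n^2 * N^2 - 4 * n^2 * N + 4 * n^2 - n * N^3 +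
    5 * n * N^2 - 6 * n * N + 4 * n + N^3 - 3 * N^2 + 2 * N)) * j +
  ((n + 1) * (4 * n^4 * N - 2 * n^4 - 14 * n^3 * N^2 + 24 * n^3 * N - 8 * n^3 +
    5 * n^2 * N^3 - 30 * n^2 * N^2 + 35 * n^2 * N - 10 * n^2 + n * N^4 - 3 * n * N^3 -
    8 * n * N^2 + 13 * n * N - 4 * n + 3 * N^4 - 9 * N^3 + 8 * N^2 - 2 * N)) * t +
  ((6 * n^3 * N^2 - 12 * n^3 * N + 4 * n^3 - n^2 * N^3 + 16 * n^2 * N^2 - 26 * n^2 * N +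
    8 * n^2 + 2 * n * N^3 + 4 * n * N^2 - 12 * n * N + 4 * n + 5 * N^3 - 7 * N^2 +
    2 * N)) * t * j +
  ((-4 * n^4 * N + 2 * n^4 - 4 * n^3 * N + 2 * n^3 + n^2 * N^3 - 6 * n^2 * N^2 +
    7 * n^2 * N - 2 * n^2 + n * N^3 - 4 * n * N^2 + 6 * n * N - 2 * n - 2 * N^3 + 3 * N^2 -
    N)) * t^2

theorem diag_cert (n N t j : ℝ) :
    diagC0 n N * ((t - n + N - 1) * (t + n + 1) * (t - j) * (N + j) * (n + 1 - j)^2) +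
      diagC1 n N * ((t + n + 1) * (t + N) * (t - j) * (N + j - n) * (n + 1 - j)^2) +
      diagC2 n N * ((n + 1) * (t - n - 1) * (t - j) * (t - j + n) * (N + j) * (N + j - n)) =
    diagP1 n N (t + 1) j * ((t - n + N - 1) * t^2 * (t - j + n)) -
      diagP1 n N t j * ((t - n - 1) * (t + n + 1) * (t + N) * (t - j)) +
      diagP2 n N t (j + 1) * ((N + j) * (n + 1 - j)^2 * (t - j)) -
      diagP2 n N t j * (j^2 * (N + j - n) * (t - j + n)) := by
  unfold diagC0 diagC1 diagC2 diagP1 diagP2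
  ring

theorem row_cert (n N t j : ℝ) :
    rowC0 n N * ((t - n + N - 2) * (t - n + N - 1) * (t - j) * (N + j) * (N + j - 1)) +
      rowC1 n N * ((t - n + N - 2) * (t + N) * (t - j) * (N + j - 1) * (N + j - n)) +
      rowC2 n N * ((t + N) * (t + N - 1) * (t - j) * (N + j - n) * (N + j - n - 1)) =
    rowP1 n N (t + 1) j * ((t - n + N - 2) * t^2 * (t - j + n)) -
      rowP1 n N t j * ((t - n - 1) * (t + n) * (t + N) * (t - j)) +
      rowP2 n N t (j + 1) * ((N + j - 1) * (n - j)^2 * (t - j)) -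
      rowP2 n N t j * (j^2 * (N + j - n) * (t - j + n)) := by
  unfold rowC0 rowC1 rowC2 rowP1 rowP2
  ring

/-- The numerator of the antidifference for the diagonal recurrence of `Zl`. -/
noncomputable def diagL (n N t : ℝ) : ℝ :=
  (2 * n + 2 - N) / 2 *
    ((12 * n^5 + 33 * n^4 * N + 33 * n^4 + 33 * n^3 * N^2 + 65 * n^3 * N + 32 * n^3 +
      32 * n^2 * N^2 + 45 * n^2 * N + 13 * n^2 + 13 * n * N^2 + 15 * n * N + 2 * n +
      2 * N^2 + 2 * N) +
    (27 * n^4 + 67 * n^3 * N + 68 * n^3 + 67 * n^2 * N^2 + 105 * n^2 * N + 57 * n^2 +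
      38 * n * N^2 + 45 * n * N + 18 * n + 7 * N^2 + 7 * N + 2) * t +
    (20 * n^3 + 48 * n^2 * N + 45 * n^2 + 48 * n * N^2 + 60 * n * N + 30 * n + 12 * N^2 +
      12 * N + 5) * t^2 +
    (5 * n^2 + 12 * n * N + 10 * n + 12 * N^2 + 12 * N + 5) * t^3)

theorem diag_cert_left (n N t : ℝ) :
    diagC0 n N * ((2 * n - N + 1) * (2 * n - N + 2) * (t + n / 2) * (t - N) * (t + n + N) *
        (t + n + 1)^5) -
      diagC1 n N * ((2 * n - N + 2) * N * (t + n / 2) * (t + n - N) * (t + N) * (t + n + 1)^5) +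
      diagC2 n N * ((n + 1)^2 * (t + (n + 1) / 2) * (t - n - 1) * (t + n - N) * (t + 2 * n + 1) *
        (t + 2 * n + 2) * (t - N) * (t + n + N) * (t + n + N + 1)) =
    diagL n N (t + 1) * ((t + n - N) * (t + 2 * n + 1) * (t + n + N) * t^5) -
      diagL n N t * ((t - n - 1) * (t + N) * (t - N) * (t + n + 1)^5) := by
  unfold diagC0 diagC1 diagC2 diagL
  ring

/-- The numerator of the antidifference for the row recurrence of `Zl`. -/
noncomputable def rowL (n N : ℝ) : ℝ := -N * (2 * N - 1) * n * (n + 1) * (2 * n + 2 - N)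

theorem row_cert_left (n N t : ℝ) :
    rowC0 n N * ((2 * n - N + 1) * (2 * n - N + 2) * (t + n / 2) * (t - N) * (t - N + 1) *
        (t + n + N - 1) * (t + n + N)) -
      rowC1 n N * ((2 * n - N + 2) * N * (t + n / 2) * (t + n - N) * (t + N) * (t - N + 1) *
        (t + n + N - 1)) +
      rowC2 n N * (N * (N - 1) * (t + n / 2) * (t + n - N) * (t + n - N + 1) * (t + N - 1) *
        (t + N)) =
    rowL n N * ((t + n - N) * (t + 2 * n + 1) * (t + n + N - 1) * t^5) -
      rowL n N * ((t - n - 1) * (t + N) * (t - N + 1) * (t + n)^5) := by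
  unfold rowC0 rowC1 rowC2 rowL
  ring

/-- `f` agrees on `(0, ∞)` with a quotient of polynomials without positive poles which is
`O(t ^ (-k))` at infinity. -/
def IsRationalDecay (f : ℝ → ℝ) (k : ℤ) : Prop :=
  ∃ p q : ℝ[X], (∀ t : ℝ, 0 < t → q.eval t ≠ 0) ∧ (p.natDegree : ℤ) + k ≤ q.natDegree ∧
    1 ≤ q.natDegree ∧ ∀ t : ℝ, 0 < t → f t = p.eval t / q.eval t

namespace IsRationalDecay

variable {f g : ℝ → ℝ} {k l : ℤ}

theorem congr (hf : IsRationalDecay f k) (h : ∀ t : ℝ, 0 < t → g t = f t) :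
    IsRationalDecay g k := by
  obtain ⟨p, q, hq, hd, h1, he⟩ := hf
  exact ⟨p, q, hq, hd, h1, fun t ht => (h t ht).trans (he t ht)⟩

theorem mono (hf : IsRationalDecay f k) (h : l ≤ k) : IsRationalDecay f l := by
  obtain ⟨p, q, hq, hd, h1, he⟩ := hf
  exact ⟨p, q, hq, by omega, h1, he⟩

theorem mul (hf : IsRationalDecay f k) (hg : IsRationalDecay g l) :
    IsRationalDecay (fun t => f t * g t) (k + l) := by
  obtain ⟨p, q, hq, hd, h1, he⟩ := hf
  obtain ⟨p', q', hq', hd', h1', he'⟩ := hg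
  have hq0 : q ≠ 0 := by rintro rfl; simp at h1
  have hq0' : q' ≠ 0 := by rintro rfl; simp at h1'
  have hm := natDegree_mul hq0 hq0'
  have hp := natDegree_mul_le (p := p) (q := p')
  refine ⟨p * p', q * q', fun t ht => ?_, by omega, by omega, fun t ht => ?_⟩
  · rw [eval_mul]; exact mul_ne_zero (hq t ht) (hq' t ht)
  · beta_reduce
    rw [he t ht, he' t ht, eval_mul, eval_mul, div_mul_div_comm]

theorem add (hf : IsRationalDecay f k) (hg : IsRationalDecay g k) :
    IsRationalDecay (fun t => f t + g t) k := by
  obtain ⟨p, q, hq, hd, h1, he⟩ := hf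
  obtain ⟨p', q', hq', hd', h1', he'⟩ := hg
  have hq0 : q ≠ 0 := by rintro rfl; simp at h1
  have hq0' : q' ≠ 0 := by rintro rfl; simp at h1'
  have hm := natDegree_mul hq0 hq0'
  have hp := natDegree_mul_le (p := p) (q := q')
  have hp' := natDegree_mul_le (p := q) (q := p')
  have hs := natDegree_add_le (p * q') (q * p')
  refine ⟨p * q' + q * p', q * q', fun t ht => ?_, ?_, by omega, fun t ht => ?_⟩
  · rw [eval_mul]; exact mul_ne_zero (hq t ht) (hq' t ht)
  · rcases le_max_iff.1 hs with h | h <;> omega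
  · beta_reduce
    rw [he t ht, he' t ht, eval_add, eval_mul, eval_mul, eval_mul,
      div_add_div _ _ (hq t ht) (hq' t ht)]

theorem deriv (hf : IsRationalDecay f k) : IsRationalDecay (deriv f) (k + 1) := by
  obtain ⟨p, q, hq, hd, h1, he⟩ := hf
  have hq0 : q ≠ 0 := by rintro rfl; simp at h1
  have hm : (q ^ 2).natDegree = 2 * q.natDegree := natDegree_pow q 2
  have hs := natDegree_sub_le (derivative p * q) (p * derivative q)
  have ha := natDegree_mul_le (p := derivative p) (q := q)
  have hb := natDegree_mul_le (p := p) (q := derivative q)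
  have hp' := natDegree_derivative_le p
  have hq' := natDegree_derivative_le q
  have ha' : (derivative p * q).natDegree + (k + 1) ≤ 2 * q.natDegree := by
    rcases Nat.eq_zero_or_pos p.natDegree with h | h
    · rw [derivative_of_natDegree_zero h, zero_mul, natDegree_zero]; omega
    · omega
  refine ⟨derivative p * q - p * derivative q, q ^ 2, fun t ht => ?_, ?_, by omega,
    fun t ht => ?_⟩
  · rw [eval_pow]; exact pow_ne_zero 2 (hq t ht)
  · rw [hm]
    rcases le_max_iff.1 hs with h | h <;> push_cast <;> omega
  · have hee : f =ᶠ[𝓝 t] fun s => p.eval s / q.eval s := by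
      filter_upwards [lt_mem_nhds ht] with s hs using he s hs
    rw [hee.deriv_eq, ((p.hasDerivAt t).fun_div (q.hasDerivAt t) (hq t ht)).deriv]
    simp only [eval_sub, eval_mul, eval_pow]

theorem differentiableAt (hf : IsRationalDecay f k) {t : ℝ} (ht : 0 < t) :
    DifferentiableAt ℝ f t := by
  obtain ⟨p, q, hq, hd, h1, he⟩ := hf
  have hee : f =ᶠ[𝓝 t] fun s => p.eval s / q.eval s := by
    filter_upwards [lt_mem_nhds ht] with s hs using he s hs
  exact ((p.hasDerivAt t).fun_div (q.hasDerivAt t) (hq t ht)).differentiableAt.congr_of_eventuallyEq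
    hee

theorem comp_add_one (hf : IsRationalDecay f k) : IsRationalDecay (fun t => f (t + 1)) k := by
  obtain ⟨p, q, hq, hd, h1, he⟩ := hf
  have h : (X + 1 : ℝ[X]).natDegree = 1 := by simpa using natDegree_X_add_C (1 : ℝ)
  refine ⟨p.comp (X + 1), q.comp (X + 1), fun t ht => ?_, ?_, ?_, fun t ht => ?_⟩
  · simpa using hq (t + 1) (by linarith)
  · simpa [natDegree_comp, h] using hd
  · simpa [natDegree_comp, h] using h1
  · simpa using he (t + 1) (by linarith)

theorem const (c : ℝ) : IsRationalDecay (fun _ => c) 0 := by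
  have h : (X + 1 : ℝ[X]).natDegree = 1 := by simpa using natDegree_X_add_C (1 : ℝ)
  refine ⟨C c * (X + 1), X + 1, fun t ht => ?_, ?_, h.ge, fun t ht => ?_⟩
  · simp; positivity
  · have := natDegree_C_mul_le c (X + 1 : ℝ[X]); omega
  · have : t + 1 ≠ 0 := by positivity
    simp; field_simp

theorem add_const (c : ℝ) : IsRationalDecay (fun t => t + c) (-1) := by
  have h : (X + 1 : ℝ[X]).natDegree = 1 := by simpa using natDegree_X_add_C (1 : ℝ)
  have h' : (X + C c : ℝ[X]).natDegree = 1 := natDegree_X_add_C c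
  have := natDegree_mul_le (p := (X + C c : ℝ[X])) (q := X + 1)
  refine ⟨(X + C c) * (X + 1), X + 1, fun t ht => ?_, by omega, h.ge, fun t ht => ?_⟩
  · simp; positivity
  · have : t + 1 ≠ 0 := by positivity
    simp; field_simp

theorem inv_add_const {c : ℝ} (hc : 0 ≤ c) : IsRationalDecay (fun t => (t + c)⁻¹) 1 := by
  have h' : (X + C c : ℝ[X]).natDegree = 1 := natDegree_X_add_C c
  refine ⟨1, X + C c, fun t ht => ?_, by simp [h'], h'.ge, fun t ht => ?_⟩
  · simp; positivity
  · simp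

theorem const_mul (c : ℝ) (hf : IsRationalDecay f k) : IsRationalDecay (fun t => c * f t) k := by
  simpa using (const c).mul hf

theorem sum {ι : Type*} (s : Finset ι) (F : ι → ℝ → ℝ) (hk : k ≤ 0)
    (hF : ∀ i ∈ s, IsRationalDecay (F i) k) : IsRationalDecay (fun t => ∑ i ∈ s, F i t) k := by
  classical
  induction s using Finset.induction_on with
  | empty => simpa using (const 0).mono hk
  | insert a s ha ih =>
    simp only [Finset.sum_insert ha]
    exact (hF a (by simp)).add (ih fun i hi => hF i (by simp [hi]))

theorem pow (hf : IsRationalDecay f k) (a : ℕ) : IsRationalDecay (fun t => f t ^ a) (a * k) := by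
  induction a with
  | zero => simpa using const 1
  | succ a ih =>
    simp only [pow_succ]
    convert ih.mul hf using 1
    push_cast; ring

theorem poch_add (c : ℝ) (a : ℕ) : IsRationalDecay (fun t => poch (t + c) a) (-a) := by
  induction a with
  | zero => simpa [poch] using const 1
  | succ a ih =>
    simp only [poch, Finset.prod_range_succ]
    convert ih.mul (add_const (c + a)) using 1
    · ext t; simp only [poch]; ring
    · push_cast; ring

theorem inv_poch_add {c : ℝ} (hc : 0 ≤ c) (a : ℕ) :
    IsRationalDecay (fun t => (poch (t + c) a)⁻¹) a := by
  induction a with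
  | zero => simpa [poch] using const 1
  | succ a ih =>
    simp only [poch, Finset.prod_range_succ, mul_inv]
    convert ih.mul (inv_add_const (c := c + a) (by positivity)) using 1
    · ext t; simp only [poch, add_assoc]
    · push_cast; ring

theorem isBigO (hf : IsRationalDecay f k) (a : ℕ) (ha : (a : ℤ) ≤ k) :
    f =O[atTop] fun t : ℝ => (t ^ a)⁻¹ := by
  obtain ⟨p, q, hq, hd, h1, he⟩ := hf
  have hq0 : q ≠ 0 := by rintro rfl; simp at h1
  have hdeg : (p * X ^ a).degree ≤ q.degree := by
    refine degree_le_of_natDegree_le ?_ |>.trans (degree_eq_natDegree hq0).ge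
    have h := natDegree_mul_le (p := p) (q := (X : ℝ[X]) ^ a)
    rw [natDegree_X_pow] at h
    omega
  obtain ⟨c, hc⟩ := (Polynomial.isBigO_atTop_of_degree_le _ _ hdeg).bound
  refine Asymptotics.IsBigO.of_bound c ?_
  filter_upwards [hc, eventually_gt_atTop 0] with t ht ht0
  have hqt := norm_pos_iff.2 (hq t ht0)
  rw [he t ht0, norm_div, norm_inv, div_le_iff₀ hqt]
  rw [eval_mul, norm_mul, eval_pow, eval_X] at ht
  have h3 : 0 < ‖t ^ a‖ := norm_pos_iff.2 (pow_ne_zero _ ht0.ne')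
  calc ‖p.eval t‖ = ‖p.eval t‖ * ‖t ^ a‖ * ‖t ^ a‖⁻¹ := by field_simp
    _ ≤ c * ‖q.eval t‖ * ‖t ^ a‖⁻¹ := by gcongr
    _ = _ := by ring

theorem tendsto_zero (hf : IsRationalDecay f 1) : Tendsto f atTop (𝓝 0) :=
  (hf.isBigO 1 le_rfl).trans_tendsto (by simpa using tendsto_inv_atTop_zero)

theorem summable (hf : IsRationalDecay f 2) (a : ℝ) : Summable fun ν : ℕ => f (a + ν) := by
  have ht : Tendsto (fun ν : ℕ => a + (ν : ℝ)) atTop atTop :=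
    tendsto_atTop_add_const_left _ _ tendsto_natCast_atTop_atTop
  refine summable_of_isBigO_nat ?_ ((hf.isBigO 2 le_rfl).comp_tendsto ht)
  have := (Real.summable_one_div_nat_add_rpow a 2).2 (by norm_num)
  refine this.congr fun ν => ?_
  simp [add_comm]

theorem tsum_eq_of_telescope {C : ℝ → ℝ} (hf : IsRationalDecay f 2) (hC : IsRationalDecay C 1)
    (h : ∀ t : ℝ, 0 < t → f t = C (t + 1) - C t) {a : ℝ} (ha : 0 < a) :
    ∑' ν : ℕ, f (a + ν) = -C a := by
  have ht : Tendsto (fun ν : ℕ => a + (ν : ℝ)) atTop atTop :=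
    tendsto_atTop_add_const_left _ _ tendsto_natCast_atTop_atTop
  refine tendsto_nhds_unique (hf.summable a).hasSum.tendsto_sum_nat ?_
  have hs : ∀ N : ℕ, ∑ ν ∈ Finset.range N, f (a + ν) = C (a + N) - C a := by
    intro N
    have := Finset.sum_range_sub (fun ν : ℕ => C (a + ν)) N
    simp only [Nat.cast_zero, add_zero] at this
    rw [← this]
    refine Finset.sum_congr rfl fun ν _ => ?_
    rw [h _ (by positivity)]
    push_cast; ring_nf
  simp only [hs]
  simpa using (hC.tendsto_zero.comp ht).sub_const (C a)

end IsRationalDecay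

theorem deriv_eq_sub_of_telescope {f C : ℝ → ℝ} {k : ℤ} (hC : IsRationalDecay C k)
    (h : ∀ t : ℝ, 0 < t → f t = C (t + 1) - C t) (t : ℝ) (ht : 0 < t) :
    deriv f t = deriv C (t + 1) - deriv C t := by
  have hee : f =ᶠ[𝓝 t] fun s => C (s + 1) - C s := by
    filter_upwards [lt_mem_nhds ht] with s hs using h s hs
  rw [hee.deriv_eq, deriv_fun_sub (hC.comp_add_one.differentiableAt ht) (hC.differentiableAt ht),
    deriv_comp_add_const]

theorem poch_zero (x : ℝ) : poch x 0 = 1 := by simp [poch]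

theorem poch_succ (x : ℝ) (k : ℕ) : poch x (k + 1) = poch x k * (x + k) :=
  Finset.prod_range_succ _ _

theorem poch_add (x : ℝ) (a b : ℕ) : poch x (a + b) = poch x a * poch (x + a) b := by
  simp only [poch, Finset.prod_range_add, Nat.cast_add, add_assoc]

theorem poch_succ_left (x : ℝ) (k : ℕ) : poch x (k + 1) = x * poch (x + 1) k := by
  rw [add_comm, poch_add]; simp [poch]

theorem poch_pos {x : ℝ} (hx : 0 < x) (k : ℕ) : 0 < poch x k :=
  Finset.prod_pos fun i _ => by positivity

theorem poch_eq_zero {x : ℝ} {k i : ℕ} (hi : i < k) (h : x + i = 0) : poch x k = 0 :=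
  Finset.prod_eq_zero (Finset.mem_range.2 hi) h

/-- The well-poised form of `R`, for `m + N = 2 * n`. -/
noncomputable def leftR (n m N : ℕ) (t : ℝ) : ℝ :=
  (-1 : ℝ) ^ m * (n.factorial : ℝ) ^ 2 / (m.factorial * N.factorial) *
    ((t + n / 2) * poch (t + (-n)) m * poch (t + (N + 1)) m * poch (t + (-N)) N *
      poch (t + (n + 1)) N * ((poch (t + 0) (n + 1))⁻¹) ^ 4)

theorem R_eq_leftR {n m N : ℕ} (h : m + N = 2 * n) {t : ℝ} (ht : 0 < t) :
    R n m t = leftR n m N t := by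
  have hN : 2 * n - m = N := by omega
  have hc : (m : ℝ) = 2 * n - N := by
    have : (m : ℝ) + N = 2 * n := by exact_mod_cast h
    linarith
  have h1 : poch t (n + 1) * poch (t + n + 1) n = poch t (N + 1) * poch (t + (N + 1)) m := by
    have e1 := poch_add t (n + 1) n
    have e2 := poch_add t (N + 1) m
    rw [show n + 1 + n = N + 1 + m by omega, e2] at e1
    push_cast at e1
    rw [e1]; ring_nf
  have p1 := (poch_pos ht (n + 1)).ne'
  have p2 := (poch_pos ht (N + 1)).ne'
  have h2 : poch (t + n + 1) n = poch t (N + 1) * poch (t + (N + 1)) m / poch t (n + 1) := by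
    rw [← h1]; field_simp
  have e1 : t - 2 * n + m = t + (-N) := by rw [hc]; ring
  have e2 : t + n + 1 = t + ((n : ℝ) + 1) := by ring
  unfold R leftR
  rw [hN, h2, e1, e2, add_zero, sub_eq_add_neg]
  field_simp

theorem leftR_decay {n m N : ℕ} (h : m + N = 2 * n) : IsRationalDecay (leftR n m N) 3 := by
  unfold leftR
  refine IsRationalDecay.const_mul _ (((((((IsRationalDecay.add_const _).mul
    (IsRationalDecay.poch_add _ _)).mul (IsRationalDecay.poch_add _ _)).mul
    (IsRationalDecay.poch_add _ _)).mul (IsRationalDecay.poch_add _ _)).mul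
    ((IsRationalDecay.inv_poch_add le_rfl _).pow 4)).mono ?_)
  push_cast
  omega

theorem R_decay {n m : ℕ} (hmn : m ≤ n) : IsRationalDecay (R n m) 3 :=
  (leftR_decay (N := 2 * n - m) (by omega)).congr fun _ ht => R_eq_leftR (by omega) ht

theorem deriv_mul_mul_eq_zero {f g h : ℝ → ℝ} {a : ℝ} (hf : DifferentiableAt ℝ f a)
    (hg : DifferentiableAt ℝ g a) (hh : DifferentiableAt ℝ h a) (f0 : f a = 0) (g0 : g a = 0) :
    deriv (fun t => f t * g t * h t) a = 0 := by
  rw [deriv_fun_mul (hf.fun_mul hg) hh, deriv_fun_mul hf hg, f0, g0]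
  ring

theorem deriv_R_eq_zero {n m : ℕ} (hmn : m ≤ n) {s : ℕ} (hs : s < m) :
    deriv (R n m) ((n : ℝ) - m + 1 + s) = 0 := by
  obtain ⟨d, rfl⟩ := Nat.exists_eq_add_of_le hmn
  have hpos : (0 : ℝ) < (m + d : ℕ) - m + 1 + s := by push_cast; ring_nf; positivity
  have hN : m + (m + 2 * d) = 2 * (m + d) := by ring
  have hee : R (m + d) m =ᶠ[𝓝 (((m + d : ℕ) : ℝ) - m + 1 + s)] leftR (m + d) m (m + 2 * d) := by
    filter_upwards [lt_mem_nhds hpos] with t ht using R_eq_leftR hN ht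
  rw [hee.deriv_eq]
  have key := deriv_mul_mul_eq_zero
    ((IsRationalDecay.poch_add (-((m + d : ℕ) : ℝ)) m).differentiableAt hpos)
    ((IsRationalDecay.poch_add (-((m + 2 * d : ℕ) : ℝ)) (m + 2 * d)).differentiableAt hpos)
    ((IsRationalDecay.const_mul
      ((-1 : ℝ) ^ m * ((m + d).factorial : ℝ) ^ 2 / (m.factorial * (m + 2 * d).factorial))
      ((((IsRationalDecay.add_const (((m + d : ℕ) : ℝ) / 2)).mul
      (IsRationalDecay.poch_add (((m + 2 * d : ℕ) : ℝ) + 1) m)).mul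
      (IsRationalDecay.poch_add (((m + d : ℕ) : ℝ) + 1) (m + 2 * d))).mul
      ((IsRationalDecay.inv_poch_add le_rfl (m + d + 1)).pow 4))).differentiableAt hpos)
    (poch_eq_zero (i := m - 1 - s) (by omega) ?_) (poch_eq_zero (i := m + d - 1 - s) (by omega) ?_)
  · rw [← key]
    congr 1
    ext t
    unfold leftR
    ring
  · rw [Nat.sub_sub, Nat.cast_sub (by omega)]; push_cast; ring
  · have hc : ((m + d - 1 - s : ℕ) : ℝ) = m + d - 1 - s := by
      rw [Nat.sub_sub, Nat.cast_sub (by omega)]; push_cast; ring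
    rw [hc]; push_cast; ring

theorem Zl_eq_tsum {n m s : ℕ} (hmn : m ≤ n) (hs : s ≤ m) :
    Zl n m = -(1 / 3) * ∑' ν : ℕ, deriv (R n m) ((n : ℝ) - m + 1 + s + ν) := by
  have hsum := ((R_decay hmn).deriv.mono (by norm_num : (2 : ℤ) ≤ 3 + 1)).summable
    ((n : ℝ) - m + 1)
  unfold Zl
  rw [← hsum.sum_add_tsum_nat_add s, Finset.sum_eq_zero, zero_add]
  · congr 2
    ext ν
    push_cast; ring_nf
  · intro i hi
    exact deriv_R_eq_zero hmn (by have := Finset.mem_range.1 hi; omega)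

theorem factorial_cast_succ (k : ℕ) : ((k + 1).factorial : ℝ) = (k + 1) * k.factorial := by
  rw [Nat.factorial_succ]; push_cast; ring

theorem inv_poch_eq_mul_last {t : ℝ} (ht : 0 < t) (k : ℕ) :
    (poch t k)⁻¹ = (t + k) * (poch t (k + 1))⁻¹ := by
  have h : t + (k : ℝ) ≠ 0 := by positivity
  rw [poch_succ, mul_inv]
  field_simp

theorem inv_poch_eq_mul_first {t : ℝ} (ht : 0 < t) (k : ℕ) :
    (poch (t + 1) k)⁻¹ = t * (poch t (k + 1))⁻¹ := by
  rw [poch_succ_left, mul_inv]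
  field_simp

/-- The antidifference certifying the diagonal recurrence for `Zl`. -/
noncomputable def diagLeft (n m b : ℕ) (t : ℝ) : ℝ :=
  (-1 : ℝ) ^ m * (n.factorial : ℝ) ^ 2 / ((m + 2).factorial * (b + 2).factorial) *
    (diagL n (b + 2) t * poch (t + (-(n + 1))) (m + 1) * poch (t + (b + 2)) (m + 1) *
      poch (t + (-(b + 2))) (b + 2) * poch (t + (n + 1)) (b + 1) *
      ((poch (t + 0) (n + 1))⁻¹) ^ 4)

theorem diagLeft_telescope {n m b : ℕ} (h : m + b + 2 = 2 * n) {t : ℝ} (ht : 0 < t) :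
    diagC0 n (b + 2) * R n m t + diagC1 n (b + 2) * R n (m + 1) t +
      diagC2 n (b + 2) * R (n + 1) (m + 2) t = diagLeft n m b (t + 1) - diagLeft n m b t := by
  have hm : (m : ℝ) = 2 * n - (b + 2) := by
    have : (m : ℝ) + b + 2 = 2 * n := by exact_mod_cast h
    linarith
  rw [R_eq_leftR (N := b + 2) (by omega) ht, R_eq_leftR (N := b + 1) (by omega) ht,
    R_eq_leftR (N := b + 2) (by omega) ht]
  have hn0 : (n.factorial : ℝ) ≠ 0 := by positivity
  have hm0 : (m.factorial : ℝ) ≠ 0 := by positivity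
  have hb0 : ((b + 1).factorial : ℝ) ≠ 0 := by positivity
  have hf3 := factorial_cast_succ (b + 1)
  have q1 := inv_poch_eq_mul_last ht (n + 1)
  have q2 := inv_poch_eq_mul_first ht (n + 1)
  have a1 : poch (t + -(n : ℝ)) (m + 1) = poch (t - n) m * (t + n - (b + 2)) := by
    rw [poch_succ, hm]; ring_nf
  have a2 : poch (t + (-((n : ℝ) + 1))) (m + 1) = (t - n - 1) * poch (t - n) m := by
    rw [poch_succ_left]; ring_nf
  have a3 : poch (t + (-((n : ℝ) + 1))) (m + 2) =
      (t - n - 1) * poch (t - n) m * (t + n - (b + 2)) := by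
    rw [poch_succ, a2]; push_cast; rw [hm]; ring_nf
  have b1 : poch (t + ((b : ℝ) + 2)) (m + 1) = (t + b + 2) * poch (t + b + 3) m := by
    rw [poch_succ_left]; ring_nf
  have b2 : poch (t + ((b : ℝ) + 2 + 1)) (m + 1) = poch (t + b + 3) m * (t + 2 * n + 1) := by
    rw [poch_succ, hm]; ring_nf
  have b3 : poch (t + ((b : ℝ) + 2 + 1)) (m + 2) =
      poch (t + b + 3) m * (t + 2 * n + 1) * (t + 2 * n + 2) := by
    rw [poch_succ, b2]; push_cast; rw [hm]; ring_nf
  have c1 : poch (t + -((b : ℝ) + 2)) (b + 2) = (t - (b + 2)) * poch (t - b - 1) (b + 1) := by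
    rw [poch_succ_left]; ring_nf
  have c2 : poch (t - b - 1) (b + 2) = poch (t - b - 1) (b + 1) * t := by
    rw [poch_succ]; push_cast; ring_nf
  have d1 : poch (t + ((n : ℝ) + 1)) (b + 1) = (t + n + 1) * poch (t + n + 2) b := by
    rw [poch_succ_left]; ring_nf
  have d2 : poch (t + ((n : ℝ) + 1)) (b + 2) =
      (t + n + 1) * poch (t + n + 2) b * (t + n + (b + 2)) := by
    rw [poch_succ, d1]; push_cast; ring_nf
  have d3 : poch (t + n + 2) (b + 1) = poch (t + n + 2) b * (t + n + (b + 2)) := by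
    rw [poch_succ]; ring_nf
  have d4 : poch (t + n + 2) (b + 2) =
      poch (t + n + 2) b * (t + n + (b + 2)) * (t + n + (b + 2) + 1) := by
    rw [poch_succ, d3]; push_cast; ring_nf
  have e0 : t + ((b : ℝ) + 2 + 1) = t + b + 3 := by ring
  have e1 : t + 1 + -((n : ℝ) + 1) = t + -(n : ℝ) := by ring
  have e2 : t + 1 + ((b : ℝ) + 2) = t + (b + 2 + 1) := by ring
  have e3 : t + 1 + -((b : ℝ) + 2) = t - b - 1 := by ring
  have e4 : t + 1 + ((n : ℝ) + 1) = t + n + 2 := by ring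
  have e5 : t + -((b : ℝ) + 1) = t - b - 1 := by ring
  have e6 : t + ((b : ℝ) + 1 + 1) = t + (b + 2) := by ring
  have e7 : t + ((n : ℝ) + 1 + 1) = t + n + 2 := by ring
  have e8 : t + -(n : ℝ) = t - n := by ring
  unfold leftR diagLeft
  push_cast at q1 q2 ⊢
  simp only [add_zero, e1, e2, e3, e4, e5, e6, e7, q1, q2, a1, a2, a3, b1, b2, b3, c1, c2,
    d1, d2, d3, d4]
  simp only [e0, e8, pow_succ (-1 : ℝ), hf3, factorial_cast_succ n, factorial_cast_succ (m + 1),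
    factorial_cast_succ m, Nat.cast_add, Nat.cast_one]
  have key := diag_cert_left n (b + 2) t
  set A1 := poch (t - n) m
  set A2 := poch (t + b + 3) m
  set A3 := poch (t - b - 1) (b + 1)
  set A4 := poch (t + n + 2) b
  set Q := (poch t (n + 2))⁻¹
  have hm1 : (m : ℝ) + 1 ≠ 0 := by positivity
  have hm2 : (m : ℝ) + 1 + 1 ≠ 0 := by positivity
  have hb2 : (b : ℝ) + 1 + 1 ≠ 0 := by positivity
  have k1 : ∀ x : ℝ, x / (m.factorial * (((b : ℝ) + 1 + 1) * (b + 1).factorial)) =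
      x * ((m + 1) * (m + 2)) / (((m : ℝ) + 1 + 1) * ((m + 1) * m.factorial) *
        (((b : ℝ) + 1 + 1) * (b + 1).factorial)) := by
    intro x; field_simp; ring
  have k2 : ∀ x : ℝ, x / (((m : ℝ) + 1) * m.factorial * (b + 1).factorial) =
      x * ((m + 2) * (b + 2)) / (((m : ℝ) + 1 + 1) * ((m + 1) * m.factorial) *
        (((b : ℝ) + 1 + 1) * (b + 1).factorial)) := by
    intro x; field_simp; ring
  rw [k1, k2]
  generalize (((m : ℝ) + 1 + 1) * ((m + 1) * m.factorial) *
        (((b : ℝ) + 1 + 1) * (b + 1).factorial)) = D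
  rw [hm]
  linear_combination ((-1 : ℝ) ^ m * (n.factorial : ℝ) ^ 2 / D * A1 * A2 * A3 * A4 * Q ^ 4) * key

theorem deriv_combination_of_telescope {f₀ f₁ f₂ C : ℝ → ℝ} {k l : ℤ} {c₀ c₁ c₂ : ℝ}
    (h₀ : IsRationalDecay f₀ k) (h₁ : IsRationalDecay f₁ k) (h₂ : IsRationalDecay f₂ k)
    (hC : IsRationalDecay C l)
    (h : ∀ t : ℝ, 0 < t → c₀ * f₀ t + c₁ * f₁ t + c₂ * f₂ t = C (t + 1) - C t) (t : ℝ)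
    (ht : 0 < t) :
    c₀ * deriv f₀ t + c₁ * deriv f₁ t + c₂ * deriv f₂ t = deriv C (t + 1) - deriv C t := by
  have d₀ := (h₀.differentiableAt ht).const_mul c₀
  have d₁ := (h₁.differentiableAt ht).const_mul c₁
  have d₂ := (h₂.differentiableAt ht).const_mul c₂
  rw [← deriv_eq_sub_of_telescope hC h t ht, deriv_fun_add (d₀.fun_add d₁) d₂,
    deriv_fun_add d₀ d₁, deriv_const_mul_field, deriv_const_mul_field, deriv_const_mul_field]

theorem tsum_combination_of_telescope {f₀ f₁ f₂ C : ℝ → ℝ} {c₀ c₁ c₂ : ℝ}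
    (h₀ : IsRationalDecay f₀ 2) (h₁ : IsRationalDecay f₁ 2) (h₂ : IsRationalDecay f₂ 2)
    (hC : IsRationalDecay C 1)
    (h : ∀ t : ℝ, 0 < t → c₀ * f₀ t + c₁ * f₁ t + c₂ * f₂ t = C (t + 1) - C t) {a : ℝ}
    (ha : 0 < a) :
    c₀ * ∑' ν : ℕ, f₀ (a + ν) + c₁ * ∑' ν : ℕ, f₁ (a + ν) + c₂ * ∑' ν : ℕ, f₂ (a + ν) = -C a := by
  have s₀ := (h₀.summable a).mul_left c₀
  have s₁ := (h₁.summable a).mul_left c₁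
  have s₂ := (h₂.summable a).mul_left c₂
  rw [← tsum_mul_left, ← tsum_mul_left, ← tsum_mul_left, ← s₀.tsum_add s₁,
    ← (s₀.add s₁).tsum_add s₂]
  exact IsRationalDecay.tsum_eq_of_telescope
    (((h₀.const_mul c₀).add (h₁.const_mul c₁)).add (h₂.const_mul c₂)) hC h ha

theorem IsRationalDecay.id : IsRationalDecay (fun t => t) (-1) :=
  (IsRationalDecay.add_const 0).congr fun t _ => (add_zero t).symm

theorem diagL_decay (n N : ℝ) : IsRationalDecay (diagL n N) (-3) := by
  unfold diagL
  exact IsRationalDecay.const_mul _ (((((IsRationalDecay.const _).mono (by norm_num)).add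
    ((IsRationalDecay.id.const_mul _).mono (by norm_num))).add
    (((IsRationalDecay.id.pow 2).const_mul _).mono (by norm_num))).add
    (((IsRationalDecay.id.pow 3).const_mul _).mono (by norm_num)))

theorem diagLeft_decay {n m b : ℕ} (h : m + b + 2 = 2 * n) :
    IsRationalDecay (diagLeft n m b) 0 := by
  unfold diagLeft
  refine IsRationalDecay.const_mul _ ((((((diagL_decay _ _).mul
    (IsRationalDecay.poch_add _ _)).mul (IsRationalDecay.poch_add _ _)).mul
    (IsRationalDecay.poch_add _ _)).mul (IsRationalDecay.poch_add _ _)).mul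
    ((IsRationalDecay.inv_poch_add le_rfl _).pow 4)|>.mono ?_)
  push_cast
  omega

theorem deriv_diagLeft_eq_zero {n m b : ℕ} (h : m + b + 2 = 2 * n) (hb : n ≤ b + 1) :
    deriv (diagLeft n m b) (n + 1) = 0 := by
  have hpos : (0 : ℝ) < n + 1 := by positivity
  have key := deriv_mul_mul_eq_zero
    ((IsRationalDecay.poch_add (-((n : ℝ) + 1)) (m + 1)).differentiableAt hpos)
    ((IsRationalDecay.poch_add (-((b : ℝ) + 2)) (b + 2)).differentiableAt hpos)
    ((IsRationalDecay.const_mul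
      ((-1 : ℝ) ^ m * (n.factorial : ℝ) ^ 2 / ((m + 2).factorial * (b + 2).factorial))
      ((((diagL_decay n (b + 2)).mul (IsRationalDecay.poch_add ((b : ℝ) + 2) (m + 1))).mul
      (IsRationalDecay.poch_add ((n : ℝ) + 1) (b + 1))).mul
      ((IsRationalDecay.inv_poch_add le_rfl (n + 1)).pow 4))).differentiableAt hpos)
    (poch_eq_zero (i := 0) (by omega) (by push_cast; ring))
    (poch_eq_zero (i := b + 1 - n) (by omega) (by push_cast [hb]; ring))
  rw [← key]
  congr 1
  ext t
  unfold diagLeft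
  ring

theorem Zl_diag {n m b : ℕ} (h : m + b + 2 = 2 * n) (hb : n ≤ b + 1) :
    diagC0 n (b + 2) * Zl n m + diagC1 n (b + 2) * Zl n (m + 1) +
      diagC2 n (b + 2) * Zl (n + 1) (m + 2) = 0 := by
  have hpos : (0 : ℝ) < n + 1 := by positivity
  have r₀ := R_decay (n := n) (m := m) (by omega)
  have r₁ := R_decay (n := n) (m := m + 1) (by omega)
  have r₂ := R_decay (n := n + 1) (m := m + 2) (by omega)
  have hC := diagLeft_decay h
  have key := tsum_combination_of_telescope (r₀.deriv.mono (by norm_num))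
    (r₁.deriv.mono (by norm_num)) (r₂.deriv.mono (by norm_num)) hC.deriv
    (deriv_combination_of_telescope r₀ r₁ r₂ hC fun t ht => diagLeft_telescope h ht) hpos
  rw [deriv_diagLeft_eq_zero h hb] at key
  rw [Zl_eq_tsum (s := m) (by omega) le_rfl, Zl_eq_tsum (s := m + 1) (by omega) le_rfl,
    Zl_eq_tsum (s := m + 1) (by omega) (by omega)]
  have e₀ : (n : ℝ) - m + 1 + m = n + 1 := by ring
  have e₁ : (n : ℝ) - (m + 1 : ℕ) + 1 + (m + 1 : ℕ) = n + 1 := by push_cast; ring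
  have e₂ : ((n + 1 : ℕ) : ℝ) - (m + 2 : ℕ) + 1 + (m + 1 : ℕ) = n + 1 := by push_cast; ring
  rw [e₀, e₁, e₂]
  linear_combination (-1 / 3 : ℝ) * key

/-- The antidifference certifying the row recurrence for `Zl`. -/
noncomputable def rowLeft (n m b : ℕ) (t : ℝ) : ℝ :=
  (-1 : ℝ) ^ m * (n.factorial : ℝ) ^ 2 / ((m + 2).factorial * (b + 2).factorial) *
    rowL n (b + 2) * (poch (t + (-(n + 1))) (m + 1) * poch (t + (b + 2)) (m + 1) *
      poch (t + (-(b + 1))) (b + 1) * poch (t + n) (b + 1) * ((poch (t + 0) n)⁻¹) ^ 4)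

theorem rowLeft_telescope {n m b : ℕ} (h : m + b + 2 = 2 * n) {t : ℝ} (ht : 0 < t) :
    rowC0 n (b + 2) * R n m t + rowC1 n (b + 2) * R n (m + 1) t +
      rowC2 n (b + 2) * R n (m + 2) t = rowLeft n m b (t + 1) - rowLeft n m b t := by
  have hm : (m : ℝ) = 2 * n - (b + 2) := by
    have : (m : ℝ) + b + 2 = 2 * n := by exact_mod_cast h
    linarith
  rw [R_eq_leftR (N := b + 2) (by omega) ht, R_eq_leftR (N := b + 1) (by omega) ht,
    R_eq_leftR (N := b) (by omega) ht]
  have hn0 : (n.factorial : ℝ) ≠ 0 := by positivity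
  have hm0 : (m.factorial : ℝ) ≠ 0 := by positivity
  have hb0 : (b.factorial : ℝ) ≠ 0 := by positivity
  have q1 := inv_poch_eq_mul_last ht n
  have q2 := inv_poch_eq_mul_first ht n
  have a1 : poch (t + -(n : ℝ)) (m + 1) = poch (t + -(n : ℝ)) m * (t + n - (b + 2)) := by
    rw [poch_succ, hm]; ring_nf
  have a2 : poch (t + (-((n : ℝ) + 1))) (m + 1) = (t - n - 1) * poch (t + -(n : ℝ)) m := by
    rw [poch_succ_left]; ring_nf
  have a3 : poch (t + -(n : ℝ)) (m + 2) =
      poch (t + -(n : ℝ)) m * (t + n - (b + 2)) * (t + n - (b + 2) + 1) := by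
    rw [poch_succ, a1]; push_cast; rw [hm]; ring_nf
  have b1 : poch (t + ((b : ℝ) + 2)) (m + 1) = (t + b + 2) * poch (t + (b + 2 + 1)) m := by
    rw [poch_succ_left]; ring_nf
  have b2 : poch (t + ((b : ℝ) + 2 + 1)) (m + 1) =
      poch (t + (b + 2 + 1)) m * (t + 2 * n + 1) := by
    rw [poch_succ, hm]; ring_nf
  have b3 : poch (t + ((b : ℝ) + 1)) (m + 2) =
      (t + b + 1) * ((t + b + 2) * poch (t + (b + 2 + 1)) m) := by
    rw [poch_succ_left, ← b1]; ring_nf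
  have c1 : poch (t + -((b : ℝ) + 2)) (b + 2) =
      (t - (b + 2)) * ((t - (b + 1)) * poch (t + -(b : ℝ)) b) := by
    rw [poch_succ_left, poch_succ_left]; ring_nf
  have c2 : poch (t + -(b : ℝ)) (b + 1) = poch (t + -(b : ℝ)) b * t := by
    rw [poch_succ]; ring_nf
  have c3 : poch (t + -((b : ℝ) + 1)) (b + 1) = (t - (b + 1)) * poch (t + -(b : ℝ)) b := by
    rw [poch_succ_left]; ring_nf
  have d1 : poch (t + n) (b + 1) = (t + n) * poch (t + (n + 1)) b := by
    rw [poch_succ_left]; ring_nf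
  have d2 : poch (t + ((n : ℝ) + 1)) (b + 1) = poch (t + (n + 1)) b * (t + n + (b + 1)) := by
    rw [poch_succ]; ring_nf
  have d3 : poch (t + ((n : ℝ) + 1)) (b + 2) =
      poch (t + (n + 1)) b * (t + n + (b + 1)) * (t + n + (b + 2)) := by
    rw [poch_succ, d2]; push_cast; ring_nf
  have e1 : t + 1 + -((n : ℝ) + 1) = t + -(n : ℝ) := by ring
  have e2 : t + 1 + ((b : ℝ) + 2) = t + (b + 2 + 1) := by ring
  have e3 : t + 1 + -((b : ℝ) + 1) = t + -(b : ℝ) := by ring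
  have e4 : t + 1 + (n : ℝ) = t + (n + 1) := by ring
  have e6 : t + ((b : ℝ) + 1 + 1) = t + (b + 2) := by ring
  unfold leftR rowLeft
  push_cast
  simp only [add_zero, e1, e2, e3, e4, e6, q1, q2, a1, a2, a3, b1, b2, b3, c1, c2, c3,
    d1, d2, d3]
  simp only [pow_succ (-1 : ℝ), factorial_cast_succ (b + 1), factorial_cast_succ b,
    factorial_cast_succ (m + 1), factorial_cast_succ m, Nat.cast_add, Nat.cast_one]
  have key := row_cert_left n (b + 2) t
  generalize poch (t + -(n : ℝ)) m = A1
  generalize poch (t + ((b : ℝ) + 2 + 1)) m = A2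
  generalize poch (t + -(b : ℝ)) b = A3
  generalize poch (t + ((n : ℝ) + 1)) b = A4
  generalize (poch t (n + 1))⁻¹ = Q
  have hm1 : (m : ℝ) + 1 ≠ 0 := by positivity
  have hm2 : (m : ℝ) + 1 + 1 ≠ 0 := by positivity
  have hb1 : (b : ℝ) + 1 ≠ 0 := by positivity
  have hb2 : (b : ℝ) + 1 + 1 ≠ 0 := by positivity
  have k1 : ∀ x : ℝ, x / (m.factorial * (((b : ℝ) + 1 + 1) * ((b + 1) * b.factorial))) =
      x * ((m + 1) * (m + 2)) / (((m : ℝ) + 1 + 1) * ((m + 1) * m.factorial) *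
        (((b : ℝ) + 1 + 1) * ((b + 1) * b.factorial))) := by
    intro x; field_simp; ring
  have k2 : ∀ x : ℝ, x / (((m : ℝ) + 1) * m.factorial * ((b + 1) * b.factorial)) =
      x * ((m + 2) * (b + 2)) / (((m : ℝ) + 1 + 1) * ((m + 1) * m.factorial) *
        (((b : ℝ) + 1 + 1) * ((b + 1) * b.factorial))) := by
    intro x; field_simp; ring
  have k3 : ∀ x : ℝ, x / (((m : ℝ) + 1 + 1) * ((m + 1) * m.factorial) * b.factorial) =
      x * ((b + 1) * (b + 2)) / (((m : ℝ) + 1 + 1) * ((m + 1) * m.factorial) *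
        (((b : ℝ) + 1 + 1) * ((b + 1) * b.factorial))) := by
    intro x; field_simp; ring
  rw [k1, k2, k3]
  generalize (((m : ℝ) + 1 + 1) * ((m + 1) * m.factorial) *
        (((b : ℝ) + 1 + 1) * ((b + 1) * b.factorial))) = D
  rw [hm]
  linear_combination ((-1 : ℝ) ^ m * (n.factorial : ℝ) ^ 2 / D * A1 * A2 * A3 * A4 * Q ^ 4) * key

theorem rowLeft_decay {n m b : ℕ} (h : m + b + 2 = 2 * n) :
    IsRationalDecay (rowLeft n m b) 0 := by
  unfold rowLeft
  refine IsRationalDecay.const_mul _ (((((IsRationalDecay.poch_add _ _).mul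
    (IsRationalDecay.poch_add _ _)).mul (IsRationalDecay.poch_add _ _)).mul
    (IsRationalDecay.poch_add _ _)).mul ((IsRationalDecay.inv_poch_add le_rfl _).pow 4)|>.mono ?_)
  push_cast
  omega

theorem deriv_rowLeft_eq_zero {n m b : ℕ} (hb : n ≤ b) :
    deriv (rowLeft n m b) (n + 1) = 0 := by
  have hpos : (0 : ℝ) < n + 1 := by positivity
  have key := deriv_mul_mul_eq_zero
    ((IsRationalDecay.poch_add (-((n : ℝ) + 1)) (m + 1)).differentiableAt hpos)
    ((IsRationalDecay.poch_add (-((b : ℝ) + 1)) (b + 1)).differentiableAt hpos)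
    ((IsRationalDecay.const_mul
      ((-1 : ℝ) ^ m * (n.factorial : ℝ) ^ 2 / ((m + 2).factorial * (b + 2).factorial) *
        rowL n (b + 2))
      (((IsRationalDecay.poch_add ((b : ℝ) + 2) (m + 1)).mul
      (IsRationalDecay.poch_add (n : ℝ) (b + 1))).mul
      ((IsRationalDecay.inv_poch_add le_rfl n).pow 4))).differentiableAt hpos)
    (poch_eq_zero (i := 0) (by omega) (by push_cast; ring))
    (poch_eq_zero (i := b - n) (by omega) (by push_cast [hb]; ring))
  rw [← key]
  congr 1
  ext t
  unfold rowLeft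
  ring

theorem Zl_row {n m b : ℕ} (h : m + b + 2 = 2 * n) (hb : n ≤ b) :
    rowC0 n (b + 2) * Zl n m + rowC1 n (b + 2) * Zl n (m + 1) +
      rowC2 n (b + 2) * Zl n (m + 2) = 0 := by
  have hpos : (0 : ℝ) < n + 1 := by positivity
  have r₀ := R_decay (n := n) (m := m) (by omega)
  have r₁ := R_decay (n := n) (m := m + 1) (by omega)
  have r₂ := R_decay (n := n) (m := m + 2) (by omega)
  have hC := rowLeft_decay h
  have key := tsum_combination_of_telescope (r₀.deriv.mono (by norm_num))
    (r₁.deriv.mono (by norm_num)) (r₂.deriv.mono (by norm_num)) hC.deriv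
    (deriv_combination_of_telescope r₀ r₁ r₂ hC fun t ht => rowLeft_telescope h ht) hpos
  rw [deriv_rowLeft_eq_zero hb] at key
  rw [Zl_eq_tsum (s := m) (by omega) le_rfl, Zl_eq_tsum (s := m + 1) (by omega) le_rfl,
    Zl_eq_tsum (s := m + 2) (by omega) le_rfl]
  have e₀ : (n : ℝ) - m + 1 + m = n + 1 := by ring
  have e₁ : (n : ℝ) - (m + 1 : ℕ) + 1 + (m + 1 : ℕ) = n + 1 := by push_cast; ring
  have e₂ : (n : ℝ) - (m + 2 : ℕ) + 1 + (m + 2 : ℕ) = n + 1 := by push_cast; ring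
  rw [e₀, e₁, e₂]
  linear_combination (-1 / 3 : ℝ) * key

theorem sum_alternating_choose_mul_eval {q : ℝ[X]} {M : ℕ} (hq : q.natDegree < M) :
    ∑ j ∈ Finset.range (M + 1), (-1 : ℝ) ^ j * M.choose j * q.eval (j : ℝ) = 0 := by
  have h := congrFun (Polynomial.fwdDiff_iter_eq_zero_of_degree_lt hq) 0
  rw [fwdDiff_iter_eq_sum_shift] at h
  have h2 := congrArg (fun x => (-1 : ℝ) ^ M * x) h
  simp only [Pi.zero_apply, mul_zero, Finset.mul_sum] at h2
  rw [← h2]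
  refine Finset.sum_congr rfl fun j hj => ?_
  have hj' : j ≤ M := by have := Finset.mem_range.1 hj; omega
  obtain ⟨d, rfl⟩ := Nat.exists_eq_add_of_le hj'
  have hd : (-1 : ℝ) ^ d * (-1) ^ d = 1 := by rw [← mul_pow]; simp
  simp only [zsmul_eq_mul, nsmul_eq_mul, zero_add, mul_one, add_tsub_cancel_left]
  push_cast
  rw [pow_add]
  linear_combination (-((-1 : ℝ) ^ j * (j + d).choose j * q.eval (j : ℝ))) * hd

theorem S1_succ (M : ℕ) : S1 (M + 1) = S1 M + 1 / (M + 1) := Finset.sum_range_succ _ _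

theorem sum_alternating_choose_div (M : ℕ) :
    ∑ j ∈ Finset.range M, (-1 : ℝ) ^ j * M.choose (j + 1) / (j + 1) = S1 M := by
  induction M with
  | zero => simp [S1]
  | succ M ih =>
    have key : ∑ j ∈ Finset.range (M + 1), (-1 : ℝ) ^ j * M.choose j / (j + 1) = 1 / (M + 1) := by
      have h := sum_alternating_choose_mul_eval (q := 1) (M := M + 1) (by simp)
      rw [Finset.sum_range_succ'] at h
      simp only [eval_one, mul_one, pow_zero, Nat.choose_zero_right, Nat.cast_one] at h
      have hM : (M : ℝ) + 1 ≠ 0 := by positivity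
      rw [eq_div_iff hM, Finset.sum_mul, ← sub_eq_zero, ← neg_eq_zero, neg_sub, sub_eq_add_neg,
        add_comm, ← h, ← Finset.sum_neg_distrib]
      congr 1
      refine Finset.sum_congr rfl fun j _ => ?_
      have hc : ((M + 1 : ℕ) : ℝ) * M.choose j = (M + 1).choose (j + 1) * (j + 1 : ℕ) := by
        exact_mod_cast Nat.add_one_mul_choose_eq M j
      push_cast at hc
      have hj : (j : ℝ) + 1 ≠ 0 := by positivity
      field_simp
      rw [pow_succ]
      linear_combination (-(-1 : ℝ) ^ j) * hc
    rw [S1_succ, ← ih, ← key]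
    have e : ∑ j ∈ Finset.range M, (-1 : ℝ) ^ j * M.choose (j + 1) / (j + 1) =
        ∑ j ∈ Finset.range (M + 1), (-1 : ℝ) ^ j * M.choose (j + 1) / (j + 1) := by
      rw [Finset.sum_range_succ]; simp
    rw [e, ← Finset.sum_add_distrib]
    refine Finset.sum_congr rfl fun j _ => ?_
    rw [Nat.choose_succ_succ]
    push_cast; ring

theorem sum_alternating_choose_mul_eval_div {p : ℝ[X]} {M : ℕ} (hp : p.natDegree ≤ M) :
    ∑ j ∈ Finset.range M, (-1 : ℝ) ^ j * M.choose (j + 1) * p.eval ((j : ℝ) + 1) / (j + 1) =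
      p.eval 0 * S1 M + p.derivative.eval 0 := by
  have hp' := p.divX_mul_X_add
  set q := p.divX with hq
  have hd : q.natDegree = p.natDegree - 1 := p.natDegree_divX_eq_natDegree_tsub_one
  set c := p.coeff 0
  have e0 : p.eval 0 = c := by rw [← hp']; simp
  have e1 : p.derivative.eval 0 = q.eval 0 := by rw [← hp']; simp
  rcases Nat.eq_zero_or_pos M with rfl | hM
  · have : q = 0 := by
      rw [hq, eq_C_of_natDegree_le_zero hp, divX_C]
    rw [e1, this]; simp [S1]
  have h := sum_alternating_choose_mul_eval (q := q) (M := M) (by omega)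
  rw [Finset.sum_range_succ'] at h
  simp only [pow_zero, Nat.choose_zero_right, Nat.cast_one, mul_one, one_mul, Nat.cast_zero] at h
  rw [e0, e1, ← sum_alternating_choose_div, eq_neg_of_add_eq_zero_right h, Finset.mul_sum,
    ← Finset.sum_neg_distrib, ← Finset.sum_add_distrib]
  refine Finset.sum_congr rfl fun j _ => ?_
  have hj : (j : ℝ) + 1 ≠ 0 := by positivity
  have he : p.eval ((j : ℝ) + 1) = q.eval ((j : ℝ) + 1) * (j + 1) + c := by
    conv_lhs => rw [← hp']
    simp
  rw [he, Nat.cast_succ]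
  field_simp
  ring

theorem hasDerivAt_poch_add (c x : ℝ) (k : ℕ) (h : ∀ i < k, x + c + i ≠ 0) :
    HasDerivAt (fun t => poch (t + c) k)
      (poch (x + c) k * ∑ i ∈ Finset.range k, (x + c + i)⁻¹) x := by
  induction k with
  | zero => simpa [poch] using hasDerivAt_const x (1 : ℝ)
  | succ k ih =>
    have h1 := (ih fun i hi => h i (by omega)).fun_mul
      (((hasDerivAt_id' x).add_const c).add_const (k : ℝ))
    have hk := h k (by omega)
    simp only [poch_succ, Finset.sum_range_succ]
    refine h1.congr_deriv ?_
    field_simp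

theorem poch_one (k : ℕ) : poch 1 k = k.factorial := by
  induction k with
  | zero => simp [poch]
  | succ k ih => rw [poch_succ, ih, Nat.factorial_succ]; push_cast; ring

theorem poch_neg (k : ℕ) : poch (-k) k = (-1) ^ k * k.factorial := by
  induction k with
  | zero => simp [poch]
  | succ k ih =>
    rw [poch_succ_left, show -((k + 1 : ℕ) : ℝ) + 1 = -k by push_cast; ring, ih,
      Nat.factorial_succ]
    push_cast; ring

theorem sum_inv_one_add (k : ℕ) : ∑ i ∈ Finset.range k, ((1 : ℝ) + i)⁻¹ = S1 k := by
  simp only [S1, one_div, add_comm]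

theorem hasDerivAt_poch_one (k : ℕ) :
    HasDerivAt (fun t => poch t k) (k.factorial * S1 k) 1 := by
  have := hasDerivAt_poch_add 0 1 k fun i _ => by positivity
  simpa only [add_zero, poch_one, sum_inv_one_add] using this

theorem hasDerivAt_poch_sub_succ {n j : ℕ} (h : j < n) :
    HasDerivAt (fun t => poch (t + (-((j + 1 : ℕ) : ℝ))) n)
      ((-1) ^ j * j.factorial * (n - 1 - j).factorial) 1 := by
  obtain ⟨d, rfl⟩ := Nat.exists_eq_add_of_lt h
  have hf : (fun t : ℝ => poch (t + (-((j + 1 : ℕ) : ℝ))) (j + d + 1)) =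
      fun t => (t - 1) * (poch (t + (-((j + 1 : ℕ) : ℝ))) j * poch (t + 0) d) := by
    ext t
    rw [add_assoc j d 1, poch_add, add_comm d 1, poch_add _ 1 d]
    simp only [poch_succ _ 0, poch_zero]
    push_cast; ring_nf
  rw [hf]
  have d1 := ((IsRationalDecay.poch_add (-((j + 1 : ℕ) : ℝ)) j).mul
    (IsRationalDecay.poch_add 0 d)).differentiableAt one_pos
  refine (((hasDerivAt_id' (1 : ℝ)).sub_const 1).fun_mul d1.hasDerivAt).congr_deriv ?_
  rw [show (1 : ℝ) + -((j + 1 : ℕ) : ℝ) = -j by push_cast; ring, poch_neg,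
    show (1 : ℝ) + 0 = 1 by ring, poch_one, show j + d + 1 - 1 - j = d by omega]
  ring

/-- The form of `Rtilde n m` with the binomial coefficients `(2 * n - m + j).choose n` expanded,
for `m + a = n`. -/
noncomputable def rightR (n a : ℕ) (t : ℝ) : ℝ :=
  (n.factorial : ℝ)⁻¹ * (poch (t + (-n)) (n + a) * (poch (t + 0) (n + 1))⁻¹ *
    (poch (t + 0) (n + a + 1))⁻¹ * ∑ j ∈ Finset.range (n + 1),
      (n.choose j : ℝ) ^ 2 * poch (a + j + 1) n * poch (t + (-j)) n)

theorem choose_mul_factorial_eq_poch (a n : ℕ) :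
    ((a + n).choose n : ℝ) * n.factorial = poch (a + 1) n := by
  have h : poch ((a : ℝ) + 1) n * a.factorial = (a + n).factorial := by
    rw [← poch_one, ← poch_one, add_comm (a : ℝ) 1, mul_comm, ← poch_add]
  have h2 : (((a + n).choose n * n.factorial * a.factorial : ℕ) : ℝ) = (a + n).factorial := by
    rw [mul_right_comm, ← Nat.add_choose_mul_factorial_mul_factorial a n]
  have ha : (a.factorial : ℝ) ≠ 0 := by positivity
  push_cast at h2
  exact mul_right_cancel₀ ha (h2.trans h.symm)

theorem Rtilde_eq_rightR {n m a : ℕ} (h : m + a = n) (t : ℝ) : Rtilde n m t = rightR n a t := by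
  have hN : 2 * n - m = n + a := by omega
  unfold Rtilde rightR
  have hn : (n.factorial : ℝ) ≠ 0 := by positivity
  simp only [hN, add_zero, ← sub_eq_add_neg, Finset.mul_sum, div_eq_mul_inv, mul_inv]
  refine Finset.sum_congr rfl fun j _ => ?_
  have := choose_mul_factorial_eq_poch (a + j) n
  push_cast at this
  rw [← this, show n + a + j = a + j + n by ring]
  field_simp

theorem rightR_decay (n a : ℕ) : IsRationalDecay (rightR n a) 2 := by
  unfold rightR
  refine IsRationalDecay.const_mul _ ((((IsRationalDecay.poch_add _ _).mul
    (IsRationalDecay.inv_poch_add le_rfl _)).mul (IsRationalDecay.inv_poch_add le_rfl _)).mul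
    (IsRationalDecay.sum (k := -n) _ _ (by omega) fun j _ =>
      IsRationalDecay.const_mul _ (IsRationalDecay.poch_add _ _))|>.mono ?_)
  push_cast
  omega

theorem Rtilde_decay {n m : ℕ} (hmn : m ≤ n) : IsRationalDecay (Rtilde n m) 2 := by
  obtain ⟨a, h⟩ := Nat.exists_eq_add_of_le hmn
  exact (rightR_decay n a).congr fun t _ => Rtilde_eq_rightR h.symm t

/-- The antidifference certifying the diagonal recurrence for `Zr`, at `n = k + 1`. -/
noncomputable def diagRight (k e : ℕ) (t : ℝ) : ℝ :=
  (((k + 2).factorial : ℝ) * (k + 2))⁻¹ * (poch (t + (-(k + 2))) (k + 2 + e) *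
    (poch (t + 0) (k + 2))⁻¹ * (poch (t + 0) (k + 2 + e))⁻¹ * ∑ j ∈ Finset.range (k + 3),
      ((k + 2).choose j : ℝ) ^ 2 * poch (e + j + 2) k * (diagP1 (k + 1) (k + 2 + e) t j *
        poch (t + (-j)) (k + 1)))

theorem choose_succ_mul_eq (n j : ℕ) :
    (n.choose j : ℝ) = (n + 1).choose j * (n + 1 - j) / (n + 1) := by
  have hn : (n : ℝ) + 1 ≠ 0 := by positivity
  rw [eq_div_iff hn]
  rcases le_or_gt j (n + 1) with hj | hj
  · have h3 : (n.choose j : ℝ) * ((n + 1 : ℕ) : ℝ) = (n + 1).choose j * ((n + 1 - j : ℕ) : ℝ) := by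
      exact_mod_cast Nat.choose_mul_succ_eq n j
    rw [Nat.cast_sub hj] at h3
    push_cast at h3
    exact h3
  · rw [Nat.choose_eq_zero_of_lt hj, Nat.choose_eq_zero_of_lt (by omega)]
    simp

set_option maxHeartbeats 1000000 in
theorem diagRight_telescope (k e : ℕ) {t : ℝ} (ht : 0 < t) :
    diagC0 (k + 1) (k + 2 + e) * rightR (k + 1) (e + 1) t +
      diagC1 (k + 1) (k + 2 + e) * rightR (k + 1) e t +
      diagC2 (k + 1) (k + 2 + e) * rightR (k + 2) e t =
    diagRight k e (t + 1) - diagRight k e t := by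
  set V : ℕ → ℝ := fun j => diagP2 (k + 1) (k + 2 + e) t j * (((k + 2).choose j : ℝ) ^ 2 *
    poch (e + j + 2) k * j ^ 2 * (e + 1 + j) * poch (t + 1 - j) (k + 1)) with hV
  have hsum : ∑ j ∈ Finset.range (k + 3), (V (j + 1) - V j) = 0 := by
    rw [Finset.sum_range_sub]
    simp [hV]
  obtain ⟨B, hB⟩ : ∃ B, B = poch (t - (k + 1)) (k + 1 + e) * (poch t (k + 2 + 1))⁻¹ *
    (poch t (k + 2 + e + 1))⁻¹ := ⟨_, rfl⟩
  obtain ⟨D, hD⟩ : ∃ D, D = (((k + 2).factorial : ℝ) * (k + 2))⁻¹ := ⟨_, rfl⟩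
  set w : ℕ → ℝ := fun j => ((k + 2).choose j : ℝ) ^ 2 * poch (e + j + 2) k *
    poch (t + 1 - j) k with hw
  have q1 := inv_poch_eq_mul_last ht (k + 2)
  have q2 := inv_poch_eq_mul_first ht (k + 2)
  have q3 := inv_poch_eq_mul_last ht (k + 2 + e)
  have q4 := inv_poch_eq_mul_first ht (k + 2 + e)
  have a1 : poch (t + -((k : ℝ) + 1)) (k + 1 + (e + 1)) =
      poch (t - (k + 1)) (k + 1 + e) * (t + e) := by
    rw [show k + 1 + (e + 1) = k + 1 + e + 1 by ring, poch_succ, ← sub_eq_add_neg]; push_cast; ring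
  have a2 : poch (t + -((k : ℝ) + 2)) (k + 2 + e) =
      (t - (k + 2)) * poch (t - (k + 1)) (k + 1 + e) := by
    rw [show k + 2 + e = k + 1 + e + 1 by ring, poch_succ_left]; ring_nf
  have b1 : ∀ j : ℕ, poch ((e : ℝ) + 1 + j + 1) (k + 1) =
      poch (e + j + 2) k * (k + 2 + e + j) := by
    intro j; rw [poch_succ]; ring_nf
  have b2 : ∀ j : ℕ, poch ((e : ℝ) + j + 1) (k + 1) = (e + j + 1) * poch (e + j + 2) k := by
    intro j; rw [poch_succ_left]; ring_nf
  have b3 : ∀ j : ℕ, poch ((e : ℝ) + j + 1) (k + 2) =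
      (e + j + 1) * poch (e + j + 2) k * (k + 2 + e + j) := by
    intro j; rw [poch_succ, b2]; push_cast; ring_nf
  have c1 : ∀ j : ℕ, poch (t + -(j : ℝ)) (k + 1) = (t - j) * poch (t + 1 - j) k := by
    intro j; rw [poch_succ_left]; ring_nf
  have c2 : ∀ j : ℕ, poch (t + -(j : ℝ)) (k + 2) =
      (t - j) * poch (t + 1 - j) k * (t - j + k + 1) := by
    intro j; rw [poch_succ, c1]; push_cast; ring_nf
  have c3 : ∀ j : ℕ, poch (t + 1 - (j : ℝ)) (k + 1) = poch (t + 1 - j) k * (t - j + k + 1) := by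
    intro j; rw [poch_succ]; ring_nf
  have a1' : poch (t - ((k : ℝ) + 1)) (k + 2 + e) =
      poch (t - (k + 1)) (k + 1 + e) * (t + e) := by
    rw [show k + 2 + e = k + 1 + e + 1 by ring, poch_succ]; push_cast; ring
  have e1 : t + 1 + -((k : ℝ) + 2) = t - (k + 1) := by ring
  have e2 : ∀ j : ℕ, t + 1 + -(j : ℝ) = t + 1 - j := fun j => (sub_eq_add_neg _ _).symm
  have hf : ((k + 1).factorial : ℝ)⁻¹ = D * (k + 2) ^ 2 := by
    simp only [hD, factorial_cast_succ (k + 1)]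
    have : ((k + 1).factorial : ℝ) ≠ 0 := by positivity
    push_cast
    field_simp
    ring
  have hf2 : ((k + 2).factorial : ℝ)⁻¹ = D * (k + 2) := by
    simp only [hD]
    have : ((k + 2).factorial : ℝ) ≠ 0 := by positivity
    field_simp
  have hch : ∀ j : ℕ, ((k + 1).choose j : ℝ) ^ 2 * (k + 2) ^ 2 =
      (k + 2).choose j ^ 2 * (k + 2 - j) ^ 2 := by
    intro j
    have hk : (k : ℝ) + 2 ≠ 0 := by positivity
    rw [choose_succ_mul_eq]; push_cast; field_simp; ring
  have r0 : rightR (k + 1) (e + 1) t = D * B * ∑ j ∈ Finset.range (k + 3),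
      w j * ((t + e) * (t + k + 2) * (t - j) * (k + 2 + e + j) * (k + 2 - j) ^ 2) := by
    rw [Finset.sum_range_succ, show k + 2 = k + 1 + 1 by ring]
    unfold rightR
    have hz : (k : ℝ) + 2 - (k + 1 + 1 : ℕ) = 0 := by push_cast; ring
    push_cast at hz ⊢
    simp only [hz, ne_eq, OfNat.ofNat_ne_zero, not_false_eq_true, zero_pow, mul_zero, add_zero,
      Finset.mul_sum]
    refine Finset.sum_congr rfl fun j _ => ?_
    simp only [hB, w]
    rw [hf, a1, show k + 1 + (e + 1) + 1 = k + 2 + e + 1 by ring, q1, b1, c1]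
    push_cast
    linear_combination D * poch (t - (k + 1)) (k + 1 + e) * (poch t (k + 2 + 1))⁻¹ *
      (poch t (k + 2 + e + 1))⁻¹ * poch (e + j + 2) k * poch (t + 1 - j) k *
      ((t + e) * (t + k + 2) * (t - j) * (k + 2 + e + j)) * hch j
  have r1 : rightR (k + 1) e t = D * B * ∑ j ∈ Finset.range (k + 3),
      w j * ((t + k + 2) * (t + (k + 2 + e)) * (t - j) * (e + 1 + j) * (k + 2 - j) ^ 2) := by
    rw [Finset.sum_range_succ, show k + 2 = k + 1 + 1 by ring]
    unfold rightR
    have hz : (k : ℝ) + 2 - (k + 1 + 1 : ℕ) = 0 := by push_cast; ring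
    push_cast at hz ⊢
    simp only [hz, ne_eq, OfNat.ofNat_ne_zero, not_false_eq_true, zero_pow, mul_zero, add_zero,
      Finset.mul_sum]
    refine Finset.sum_congr rfl fun j _ => ?_
    simp only [hB, w]
    rw [hf, show k + 1 + e + 1 = k + 2 + e by ring, q1, q3, b2, c1, ← sub_eq_add_neg]
    push_cast
    linear_combination D * poch (t - (k + 1)) (k + 1 + e) * (poch t (k + 2 + 1))⁻¹ *
      (poch t (k + 2 + e + 1))⁻¹ * poch (e + j + 2) k * poch (t + 1 - j) k *
      ((t + k + 2) * (t + (k + 2 + e)) * (t - j) * (e + 1 + j)) * hch j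
  have r2 : rightR (k + 2) e t = D * B * ∑ j ∈ Finset.range (k + 3),
      w j * ((k + 2) * (t - (k + 2)) * (t - j) * (t - j + k + 1) * (k + 2 + e + j) *
        (e + 1 + j)) := by
    unfold rightR
    push_cast
    simp only [add_zero, Finset.mul_sum]
    refine Finset.sum_congr rfl fun j _ => ?_
    simp only [hB, w]
    rw [hf2, a2, b3, c2]
    ring
  have r3 : diagRight k e (t + 1) = D * B * ∑ j ∈ Finset.range (k + 3),
      w j * (diagP1 (k + 1) (k + 2 + e) (t + 1) j * ((t + e) * t ^ 2 * (t - j + k + 1))) := by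
    unfold diagRight
    simp only [← hD, add_zero, Finset.mul_sum]
    refine Finset.sum_congr rfl fun j _ => ?_
    simp only [hB, w]
    rw [e1, a1', q2, q4, e2, c3]
    ring
  have r4 : diagRight k e t = D * B * ∑ j ∈ Finset.range (k + 3),
      w j * (diagP1 (k + 1) (k + 2 + e) t j *
        ((t - (k + 2)) * (t + k + 2) * (t + (k + 2 + e)) * (t - j))) := by
    unfold diagRight
    simp only [← hD, add_zero, Finset.mul_sum]
    refine Finset.sum_congr rfl fun j _ => ?_
    simp only [hB, w]
    rw [a2, q1, q3, c1]
    push_cast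
    ring
  have hterm : ∀ j : ℕ, V (j + 1) - V j = w j *
      (diagP2 (k + 1) (k + 2 + e) t (j + 1) * ((k + 2 + e + j) * (k + 2 - j) ^ 2 * (t - j)) -
        diagP2 (k + 1) (k + 2 + e) t j * (j ^ 2 * (e + 1 + j) * (t - j + k + 1))) := by
    intro j
    have hc : ((k + 2).choose (j + 1) : ℝ) * (j + 1 : ℝ) = (k + 2).choose j * (k + 2 - j) := by
      rcases le_or_gt j (k + 2) with hj | hj
      · have h3 : ((k + 2).choose (j + 1) : ℝ) * ((j + 1 : ℕ) : ℝ) =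
            (k + 2).choose j * ((k + 2 - j : ℕ) : ℝ) := by
          exact_mod_cast Nat.choose_succ_right_eq (k + 2) j
        rw [Nat.cast_sub hj] at h3
        push_cast at h3
        exact h3
      · rw [Nat.choose_eq_zero_of_lt hj, Nat.choose_eq_zero_of_lt (by omega)]
        simp
    have hp : ((e : ℝ) + 1 + (j + 1)) * poch ((e : ℝ) + (j + 1) + 2) k =
        poch (e + j + 2) k * (k + 2 + e + j) := by
      rw [← b1, poch_succ_left]; ring_nf
    have e3 : poch (t + 1 - ((j : ℝ) + 1)) (k + 1) = (t - j) * poch (t + 1 - j) k := by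
      rw [← c1]; ring_nf
    simp only [hV, hw, Nat.cast_succ]
    rw [e3, c3]
    linear_combination diagP2 (k + 1) (k + 2 + e) t (j + 1) * (t - j) * poch (t + 1 - j) k *
      (((k + 2).choose (j + 1)) ^ 2 * (j + 1) ^ 2 * hp + poch (e + j + 2) k * (k + 2 + e + j) *
      ((k + 2).choose (j + 1) * (j + 1) + (k + 2).choose j * (k + 2 - j)) * hc)
  simp only [hterm] at hsum
  rw [r0, r1, r2, r3, r4, ← sub_eq_zero, ← mul_zero (D * B), ← hsum]
  simp only [Finset.mul_sum, ← Finset.sum_add_distrib, ← Finset.sum_sub_distrib]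
  refine Finset.sum_congr rfl fun j _ => ?_
  have key := diag_cert (k + 1) (k + 2 + e) t j
  linear_combination D * B * w j * key

/-- The antidifference certifying the row recurrence for `Zr`, at `n = k + 2`. -/
noncomputable def rowRight (k e : ℕ) (t : ℝ) : ℝ :=
  ((k + 2).factorial : ℝ)⁻¹ * (poch (t + (-(k + 3))) (k + 3 + e) *
    (poch (t + 0) (k + 2))⁻¹ * (poch (t + 0) (k + 4 + e))⁻¹ * ∑ j ∈ Finset.range (k + 3),
      ((k + 2).choose j : ℝ) ^ 2 * poch (e + j + 3) k * (rowP1 (k + 2) (k + 4 + e) t j *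
        poch (t + (-j)) (k + 2)))

set_option maxHeartbeats 1000000 in
theorem rowRight_telescope (k e : ℕ) {t : ℝ} (ht : 0 < t) :
    rowC0 (k + 2) (k + 4 + e) * rightR (k + 2) (e + 2) t +
      rowC1 (k + 2) (k + 4 + e) * rightR (k + 2) (e + 1) t +
      rowC2 (k + 2) (k + 4 + e) * rightR (k + 2) e t =
    rowRight k e (t + 1) - rowRight k e t := by
  set V : ℕ → ℝ := fun j => rowP2 (k + 2) (k + 4 + e) t j * (((k + 2).choose j : ℝ) ^ 2 *
    poch (e + j + 3) k * j ^ 2 * (e + 2 + j) * poch (t + 1 - j) (k + 2)) with hV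
  have hsum : ∑ j ∈ Finset.range (k + 3), (V (j + 1) - V j) = 0 := by
    rw [Finset.sum_range_sub]
    simp [hV]
  obtain ⟨B, hB⟩ : ∃ B, B = poch (t - (k + 2)) (k + 2 + e) * (poch t (k + 2 + 1))⁻¹ *
    (poch t (k + 4 + e + 1))⁻¹ := ⟨_, rfl⟩
  obtain ⟨D, hD⟩ : ∃ D, D = ((k + 2).factorial : ℝ)⁻¹ := ⟨_, rfl⟩
  set w : ℕ → ℝ := fun j => ((k + 2).choose j : ℝ) ^ 2 * poch (e + j + 3) k *
    poch (t + 1 - j) (k + 1) with hw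
  have q1 := inv_poch_eq_mul_last ht (k + 2)
  have q2 := inv_poch_eq_mul_first ht (k + 2)
  have q3 := inv_poch_eq_mul_last ht (k + 4 + e)
  have q4 := inv_poch_eq_mul_first ht (k + 4 + e)
  have q5 := inv_poch_eq_mul_last ht (k + 3 + e)
  have a0 : poch (t + -((k : ℝ) + 2)) (k + 2 + (e + 1)) =
      poch (t - (k + 2)) (k + 2 + e) * (t + e) := by
    rw [show k + 2 + (e + 1) = k + 2 + e + 1 by ring, poch_succ, ← sub_eq_add_neg]; push_cast; ring
  have a1 : poch (t + -((k : ℝ) + 2)) (k + 2 + (e + 2)) =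
      poch (t - (k + 2)) (k + 2 + e) * (t + e) * (t + e + 1) := by
    rw [show k + 2 + (e + 2) = k + 2 + (e + 1) + 1 by ring, poch_succ, a0]; push_cast; ring
  have a1' : poch (t - ((k : ℝ) + 2)) (k + 3 + e) =
      poch (t - (k + 2)) (k + 2 + e) * (t + e) := by
    rw [show k + 3 + e = k + 2 + e + 1 by ring, poch_succ]; push_cast; ring
  have a2 : poch (t + -((k : ℝ) + 3)) (k + 3 + e) =
      (t - (k + 3)) * poch (t - (k + 2)) (k + 2 + e) := by
    rw [show k + 3 + e = k + 2 + e + 1 by ring, poch_succ_left]; ring_nf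
  have b0 : ∀ j : ℕ, poch ((e : ℝ) + j + 3) (k + 1) =
      poch (e + j + 3) k * (k + 3 + e + j) := by
    intro j; rw [poch_succ]; ring_nf
  have b1 : ∀ j : ℕ, poch ((e : ℝ) + 2 + j + 1) (k + 2) =
      poch (e + j + 3) k * (k + 3 + e + j) * (k + 4 + e + j) := by
    intro j; rw [poch_succ, show (e : ℝ) + 2 + j + 1 = e + j + 3 by ring, b0]; push_cast; ring_nf
  have b2 : ∀ j : ℕ, poch ((e : ℝ) + 1 + j + 1) (k + 2) =
      (e + j + 2) * poch (e + j + 3) k * (k + 3 + e + j) := by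
    intro j
    rw [poch_succ_left, show (e : ℝ) + 1 + j + 1 + 1 = e + j + 3 by ring, b0]; ring_nf
  have b3 : ∀ j : ℕ, poch ((e : ℝ) + j + 1) (k + 2) =
      (e + j + 1) * (e + j + 2) * poch (e + j + 3) k := by
    intro j; rw [poch_succ_left, poch_succ_left]; ring_nf
  have c1 : ∀ j : ℕ, poch (t + -(j : ℝ)) (k + 2) = (t - j) * poch (t + 1 - j) (k + 1) := by
    intro j; rw [poch_succ_left]; ring_nf
  have c3 : ∀ j : ℕ, poch (t + 1 - (j : ℝ)) (k + 2) =
      poch (t + 1 - j) (k + 1) * (t - j + k + 2) := by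
    intro j; rw [poch_succ]; push_cast; ring_nf
  have e1 : t + 1 + -((k : ℝ) + 3) = t - (k + 2) := by ring
  have e2 : ∀ j : ℕ, t + 1 + -(j : ℝ) = t + 1 - j := fun j => (sub_eq_add_neg _ _).symm
  have r0 : rightR (k + 2) (e + 2) t = D * B * ∑ j ∈ Finset.range (k + 3),
      w j * ((t + e) * (t + e + 1) * (t - j) * (k + 4 + e + j) * (k + 3 + e + j)) := by
    unfold rightR
    push_cast
    simp only [add_zero, Finset.mul_sum]
    refine Finset.sum_congr rfl fun j _ => ?_
    simp only [hB, hD, w]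
    rw [a1, show k + 2 + (e + 2) + 1 = k + 4 + e + 1 by ring, b1, c1]
    ring
  have r1 : rightR (k + 2) (e + 1) t = D * B * ∑ j ∈ Finset.range (k + 3),
      w j * ((t + e) * (t + (k + 4 + e)) * (t - j) * (k + 3 + e + j) * (e + 2 + j)) := by
    unfold rightR
    push_cast
    simp only [add_zero, Finset.mul_sum]
    refine Finset.sum_congr rfl fun j _ => ?_
    simp only [hB, hD, w]
    rw [a0, show k + 2 + (e + 1) + 1 = k + 4 + e by ring, q3, b2, c1]
    push_cast
    ring
  have r2 : rightR (k + 2) e t = D * B * ∑ j ∈ Finset.range (k + 3),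
      w j * ((t + (k + 4 + e)) * (t + (k + 3 + e)) * (t - j) * (e + 2 + j) * (e + 1 + j)) := by
    unfold rightR
    push_cast
    simp only [add_zero, Finset.mul_sum]
    refine Finset.sum_congr rfl fun j _ => ?_
    simp only [hB, hD, w]
    rw [show k + 2 + e + 1 = k + 3 + e by ring, q5, show k + 3 + e + 1 = k + 4 + e by ring, q3,
      b3, c1, ← sub_eq_add_neg]
    push_cast
    ring
  have r3 : rowRight k e (t + 1) = D * B * ∑ j ∈ Finset.range (k + 3),
      w j * (rowP1 (k + 2) (k + 4 + e) (t + 1) j * ((t + e) * t ^ 2 * (t - j + k + 2))) := by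
    unfold rowRight
    simp only [← hD, add_zero, Finset.mul_sum]
    refine Finset.sum_congr rfl fun j _ => ?_
    simp only [hB, w]
    rw [e1, a1', q2, q4, e2, c3]
    ring
  have r4 : rowRight k e t = D * B * ∑ j ∈ Finset.range (k + 3),
      w j * (rowP1 (k + 2) (k + 4 + e) t j *
        ((t - (k + 3)) * (t + (k + 2)) * (t + (k + 4 + e)) * (t - j))) := by
    unfold rowRight
    simp only [← hD, add_zero, Finset.mul_sum]
    refine Finset.sum_congr rfl fun j _ => ?_
    simp only [hB, w]
    rw [a2, q1, q3, c1]
    push_cast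
    ring
  have hterm : ∀ j : ℕ, V (j + 1) - V j = w j *
      (rowP2 (k + 2) (k + 4 + e) t (j + 1) * ((k + 3 + e + j) * (k + 2 - j) ^ 2 * (t - j)) -
        rowP2 (k + 2) (k + 4 + e) t j * (j ^ 2 * (e + 2 + j) * (t - j + k + 2))) := by
    intro j
    have hc : ((k + 2).choose (j + 1) : ℝ) * (j + 1 : ℝ) = (k + 2).choose j * (k + 2 - j) := by
      rcases le_or_gt j (k + 2) with hj | hj
      · have h3 : ((k + 2).choose (j + 1) : ℝ) * ((j + 1 : ℕ) : ℝ) =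
            (k + 2).choose j * ((k + 2 - j : ℕ) : ℝ) := by
          exact_mod_cast Nat.choose_succ_right_eq (k + 2) j
        rw [Nat.cast_sub hj] at h3
        push_cast at h3
        exact h3
      · rw [Nat.choose_eq_zero_of_lt hj, Nat.choose_eq_zero_of_lt (by omega)]
        simp
    have hp : ((e : ℝ) + 2 + (j + 1)) * poch ((e : ℝ) + (j + 1) + 3) k =
        poch (e + j + 3) k * (k + 3 + e + j) := by
      rw [← b0, poch_succ_left]; ring_nf
    have e3 : poch (t + 1 - ((j : ℝ) + 1)) (k + 2) = (t - j) * poch (t + 1 - j) (k + 1) := by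
      rw [← c1]; ring_nf
    simp only [hV, hw, Nat.cast_succ]
    rw [e3, c3]
    linear_combination rowP2 (k + 2) (k + 4 + e) t (j + 1) * (t - j) * poch (t + 1 - j) (k + 1) *
      (((k + 2).choose (j + 1)) ^ 2 * (j + 1) ^ 2 * hp + poch (e + j + 3) k * (k + 3 + e + j) *
      ((k + 2).choose (j + 1) * (j + 1) + (k + 2).choose j * (k + 2 - j)) * hc)
  simp only [hterm] at hsum
  rw [r0, r1, r2, r3, r4, ← sub_eq_zero, ← mul_zero (D * B), ← hsum]
  simp only [Finset.mul_sum, ← Finset.sum_add_distrib, ← Finset.sum_sub_distrib]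
  refine Finset.sum_congr rfl fun j _ => ?_
  have key := row_cert (k + 2) (k + 4 + e) t j
  linear_combination D * B * w j * key

theorem deriv_deriv_sub_one_mul {f G : ℝ → ℝ} {l : ℤ} (hG : IsRationalDecay G l)
    (h : ∀ t : ℝ, 0 < t → f t = (t - 1) * G t) : deriv (deriv f) 1 = 2 * deriv G 1 := by
  have h1 : ∀ t : ℝ, 0 < t → deriv f t = G t + (t - 1) * deriv G t := by
    intro t ht
    have hee : f =ᶠ[𝓝 t] fun s => (s - 1) * G s := by
      filter_upwards [lt_mem_nhds ht] with s hs using h s hs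
    rw [hee.deriv_eq]
    refine (HasDerivAt.congr_deriv (((hasDerivAt_id' t).sub_const 1).fun_mul
      (hG.differentiableAt ht).hasDerivAt) ?_).deriv
    ring
  have hee : deriv f =ᶠ[𝓝 1] fun s => G s + (s - 1) * deriv G s := by
    filter_upwards [lt_mem_nhds one_pos] with s hs using h1 s hs
  rw [hee.deriv_eq]
  refine (HasDerivAt.congr_deriv ((hG.differentiableAt one_pos).hasDerivAt.fun_add
    (((hasDerivAt_id' (1 : ℝ)).sub_const 1).fun_mul
      (hG.deriv.differentiableAt one_pos).hasDerivAt)) ?_).deriv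
  ring

theorem hasDerivAt_poch_sub_one (K : ℕ) :
    HasDerivAt (fun t => poch (t + (-(K + 1))) K) (-(poch (1 + (-(K + 1))) K * S1 K)) 1 := by
  refine (hasDerivAt_poch_add _ 1 K fun i hi => ?_).congr_deriv ?_
  · have : (i : ℝ) < K := by exact_mod_cast hi
    intro h
    linarith
  · rw [← mul_neg, ← Finset.sum_range_reflect, S1, ← Finset.sum_neg_distrib]
    congr 1
    refine Finset.sum_congr rfl fun i hi => ?_
    have hi' := Finset.mem_range.1 hi
    rw [Nat.sub_sub, Nat.cast_sub (by omega), one_div, ← inv_neg]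
    push_cast
    ring

theorem deriv_deriv_eq_zero_of_hasDerivAt {Q : ℝ → ℝ} {l : ℤ} (hQ : IsRationalDecay Q l)
    (c : ℝ) (K a b e : ℕ) (hQ' : HasDerivAt Q
      (Q 1 * (S1 K + S1 a + ∑ i ∈ Finset.range b, (1 + (e : ℝ) + i)⁻¹)) 1) :
    deriv (deriv fun t => c * (poch (t + (-(K + 1))) (K + 1 + e) * (poch (t + 0) a)⁻¹ *
      (poch (t + 0) (e + b))⁻¹ * Q t)) 1 = 0 := by
  have he : (0 : ℝ) ≤ e := by positivity
  have hG : IsRationalDecay (fun t => c * (poch (t + (-(K + 1))) K * (poch (t + 0) a)⁻¹ *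
      (poch (t + e) b)⁻¹ * Q t)) _ :=
    IsRationalDecay.const_mul c ((((IsRationalDecay.poch_add _ _).mul
      (IsRationalDecay.inv_poch_add le_rfl _)).mul (IsRationalDecay.inv_poch_add he _)).mul hQ)
  rw [deriv_deriv_sub_one_mul hG, mul_eq_zero]
  · right
    have d0 := hasDerivAt_poch_sub_one K
    have pa : poch (1 + 0) a ≠ 0 := (poch_pos (by norm_num) _).ne'
    have pb : poch (1 + (e : ℝ)) b ≠ 0 := (poch_pos (by positivity) _).ne'
    have d1 := (hasDerivAt_poch_add 0 1 a fun i _ => by positivity).fun_inv pa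
    have d2 := (hasDerivAt_poch_add e 1 b fun i _ => by positivity).fun_inv pb
    refine (HasDerivAt.congr_deriv ((((d0.fun_mul d1).fun_mul d2).fun_mul hQ').const_mul c)
      ?_).deriv
    simp only [add_zero, sum_inv_one_add] at pa ⊢
    field_simp
    ring
  · intro t ht
    have hp : poch (t + (-((K : ℝ) + 1))) (K + 1 + e) =
        poch (t + (-(K + 1))) K * ((t - 1) * poch t e) := by
      rw [add_assoc, poch_add, add_comm 1 e, poch_succ_left]
      ring_nf
    have hpe : poch t e ≠ 0 := (poch_pos ht _).ne'
    rw [hp, add_zero, poch_add t e b, mul_inv]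
    field_simp

theorem sum_alternating_quadratic_mul_poch (k : ℕ) {c : ℝ} (hc : 0 < c) (c₀ c₁ c₂ : ℝ) :
    ∑ j ∈ Finset.range (k + 2), (-1) ^ j * ((k + 2).choose (j + 1) : ℝ) *
      ((c₀ + c₁ * (j + 1) + c₂ * (j + 1) ^ 2) * poch (j + 1 + c) k) / (j + 1) =
    poch c k * (c₀ * S1 (k + 2) + c₁ + c₀ * ∑ i ∈ Finset.range k, (c + i)⁻¹) := by
  set r : ℝ[X] := C c₂ * X ^ 2 + C c₁ * X + C c₀ with hr
  set s : ℝ[X] := ∏ i ∈ Finset.range k, (X + C (c + i)) with hs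
  have hse : ∀ x, s.eval x = poch (x + c) k := by
    intro x
    simp only [hs, eval_prod, poch, eval_add, eval_X, eval_C, add_assoc]
  have hre : ∀ x, r.eval x = c₀ + c₁ * x + c₂ * x ^ 2 := by
    intro x
    simp only [hr, eval_add, eval_mul, eval_C, eval_X, eval_pow]
    ring
  have hds : s.natDegree ≤ k := by
    refine (natDegree_prod_le _ _).trans ?_
    simp only [natDegree_X_add_C, Finset.sum_const, Finset.card_range, smul_eq_mul, mul_one,
      le_refl]
  have hdr : r.natDegree ≤ 2 := natDegree_quadratic_le
  have hd : (r * s).natDegree ≤ k + 2 := natDegree_mul_le.trans (by omega)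
  have h := sum_alternating_choose_mul_eval_div hd
  have hs' : s.derivative.eval 0 = poch c k * ∑ i ∈ Finset.range k, (c + i)⁻¹ := by
    have h1 := s.hasDerivAt 0
    have h2 := hasDerivAt_poch_add c 0 k fun i _ => by positivity
    simp only [← hse, zero_add] at h2
    rw [h1.unique h2]
  have hr' : r.derivative.eval 0 = c₁ := by simp [hr]
  simp only [eval_mul, hre, hse] at h
  rw [h, derivative_mul, eval_add, eval_mul, eval_mul, hs', hr', hre, hse, zero_add]
  ring

theorem choose_mul_factorial_div {K j : ℕ} (h : j < K) :
    (K.choose (j + 1) : ℝ) * (j.factorial * (K - 1 - j).factorial) = K.factorial / (j + 1) := by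
  have hj : (j : ℝ) + 1 ≠ 0 := by positivity
  rw [eq_div_iff hj]
  have h1 := Nat.choose_mul_factorial_mul_factorial (show j + 1 ≤ K from h)
  rw [show K - (j + 1) = K - 1 - j by omega, Nat.factorial_succ] at h1
  have h2 : ((K.choose (j + 1) * ((j + 1) * j.factorial) * (K - 1 - j).factorial : ℕ) : ℝ) =
      K.factorial := by rw [h1]
  push_cast at h2
  linear_combination h2

theorem isRationalDecay_affine (a b : ℝ) : IsRationalDecay (fun t => a + (t - 1) * b) (-1) := by
  refine (((IsRationalDecay.const a).mono (by norm_num)).add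
    ((IsRationalDecay.add_const (-1)).const_mul b)).congr fun t _ => ?_
  ring

theorem isRationalDecay_antidifference (c : ℝ) (K a N r l : ℕ) (P : ℝ → ℕ → ℝ) (w : ℕ → ℝ)
    (hP : ∀ t j, P t j = P 1 j + (t - 1) * (P 2 j - P 1 j)) (x : ℝ) (h : l + K + 1 ≤ a + N) :
    IsRationalDecay (fun t => c * (poch (t + x) l * (poch (t + 0) a)⁻¹ *
      (poch (t + 0) N)⁻¹ * ∑ j ∈ Finset.range r, w j * (P t j * poch (t + (-j)) K))) 0 := by
  have hsum : IsRationalDecay (fun t => ∑ j ∈ Finset.range r, w j * (P t j * poch (t + (-j)) K))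
      (-1 + -K) :=
    IsRationalDecay.sum _ _ (by omega) fun j _ => IsRationalDecay.const_mul _
      (((isRationalDecay_affine _ _).congr fun t _ => hP t j).mul (IsRationalDecay.poch_add _ _))
  refine IsRationalDecay.const_mul _ ((((IsRationalDecay.poch_add _ _).mul
    (IsRationalDecay.inv_poch_add le_rfl _)).mul (IsRationalDecay.inv_poch_add le_rfl _)).mul
    hsum|>.mono ?_)
  omega

theorem hasDerivAt_affine (a b : ℝ) : HasDerivAt (fun t => a + (t - 1) * b) b 1 :=
  ((((hasDerivAt_id' (1 : ℝ)).sub_const 1).mul_const b).const_add a).congr_deriv (one_mul b)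

theorem hasDerivAt_affine_mul_poch_zero (a b : ℝ) (K : ℕ) :
    HasDerivAt (fun t => (a + (t - 1) * b) * poch (t + (-((0 : ℕ) : ℝ))) K)
      (K.factorial * (b + a * S1 K)) 1 := by
  simp only [Nat.cast_zero, neg_zero, add_zero]
  refine ((hasDerivAt_affine a b).fun_mul (hasDerivAt_poch_one K)).congr_deriv ?_
  rw [poch_one]
  ring

theorem poch_one_sub_succ {K j : ℕ} (h : j < K) : poch (1 + (-((j + 1 : ℕ) : ℝ))) K = 0 :=
  poch_eq_zero h (by push_cast; ring)

theorem hasDerivAt_affine_mul_poch_succ (a b : ℝ) {K j : ℕ} (h : j < K) :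
    HasDerivAt (fun t => (a + (t - 1) * b) * poch (t + (-((j + 1 : ℕ) : ℝ))) K)
      (a * ((-1) ^ j * j.factorial * (K - 1 - j).factorial)) 1 := by
  refine ((hasDerivAt_affine a b).fun_mul (hasDerivAt_poch_sub_succ h)).congr_deriv ?_
  rw [poch_one_sub_succ h]
  ring

theorem hasDerivAt_mul_poch_self (b : ℝ) (K : ℕ) :
    HasDerivAt (fun t => (0 + (t - 1) * b) * poch (t + (-((K + 1 : ℕ) : ℝ))) K)
      (b * ((-1) ^ K * K.factorial)) 1 := by
  have h := hasDerivAt_poch_sub_one K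
  push_cast
  refine ((hasDerivAt_affine 0 b).fun_mul h).congr_deriv ?_
  rw [← poch_neg]
  ring_nf

theorem rowP1_affine (n N t j : ℝ) :
    rowP1 n N t j = rowP1 n N 1 j + (t - 1) * (rowP1 n N 2 j - rowP1 n N 1 j) := by
  unfold rowP1; ring

theorem rowP1_quadratic (n N j : ℝ) : rowP1 n N 1 j = rowP1 n N 1 0 +
    (rowP1 n N 1 1 - rowP1 n N 1 (-1)) / 2 * j +
    ((rowP1 n N 1 1 + rowP1 n N 1 (-1)) / 2 - rowP1 n N 1 0) * j ^ 2 := by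
  unfold rowP1; ring

theorem rowP1_boundary (n N : ℝ) :
    (rowP1 n N 2 0 - rowP1 n N 1 0 + (rowP1 n N 1 1 - rowP1 n N 1 (-1)) / 2) *
      ((N - n - 1) * (N - n) * (N - 1) * N) =
    rowP1 n N 1 0 * ((N - n) * (N - 1) * N + (N - n - 1) * (N - 1) * N +
      (N - n - 1) * (N - n) * N + (N - n - 1) * (N - n) * (N - 1)) := by
  unfold rowP1; ring

theorem diagP1_affine (n N t j : ℝ) :
    diagP1 n N t j = diagP1 n N 1 j + (t - 1) * (diagP1 n N 2 j - diagP1 n N 1 j) := by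
  unfold diagP1; ring

/-- The slope in `j` of `diagP1 n N 1 j / (n + 1 - j)`. -/
noncomputable def diagSlope (n N : ℝ) : ℝ :=
  diagP1 n N 1 0 - (diagP1 n N 1 1 + diagP1 n N 1 (-1)) / 2

/-- The value at `j = 0` of `diagP1 n N 1 j / (n + 1 - j)`. -/
noncomputable def diagIntercept (n N : ℝ) : ℝ :=
  (n + 1) * diagSlope n N - (diagP1 n N 1 1 - diagP1 n N 1 (-1)) / 2

theorem diagP1_factor (n N j : ℝ) :
    diagP1 n N 1 j = (n + 1 - j) * (diagIntercept n N + diagSlope n N * j) := by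
  unfold diagIntercept diagSlope diagP1; ring

theorem diagP1_last (n N : ℝ) :
    diagP1 n N 2 (n + 1) - diagP1 n N 1 (n + 1) =
      diagIntercept n N + diagSlope n N * (n + 1) := by
  unfold diagIntercept diagSlope diagP1; ring

theorem diagP1_boundary (n N : ℝ) :
    (diagP1 n N 2 0 - diagP1 n N 1 0 + (n + 1) * diagSlope n N) * ((N - n) * N) =
      diagP1 n N 1 0 * (N + (N - n)) := by
  unfold diagSlope diagP1; ring

theorem sum_inv_interval_diag (k : ℕ) (e : ℝ) : ∑ i ∈ Finset.range (k + 2), (1 + e + i)⁻¹ =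
    (1 + e)⁻¹ + ∑ i ∈ Finset.range k, (e + 2 + i)⁻¹ + (e + k + 2)⁻¹ := by
  rw [Finset.sum_range_succ, Finset.sum_range_succ']
  push_cast
  ring_nf

theorem sum_inv_interval_row (k : ℕ) (e : ℝ) : ∑ i ∈ Finset.range (k + 4), (1 + e + i)⁻¹ =
    (1 + e)⁻¹ + (2 + e)⁻¹ + ∑ i ∈ Finset.range k, (e + 3 + i)⁻¹ + (e + k + 3)⁻¹ +
      (e + k + 4)⁻¹ := by
  rw [Finset.sum_range_succ, Finset.sum_range_succ, Finset.sum_range_succ',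
    Finset.sum_range_succ']
  push_cast
  ring_nf

theorem rowRight_decay (k e : ℕ) : IsRationalDecay (rowRight k e) 0 :=
  isRationalDecay_antidifference _ _ _ _ _ _ (fun t j => rowP1 (k + 2) (k + 4 + e) t j) _
    (fun _ _ => rowP1_affine _ _ _ _) _ (by omega)

theorem diagRight_decay (k e : ℕ) : IsRationalDecay (diagRight k e) 0 :=
  isRationalDecay_antidifference _ _ _ _ _ _ (fun t j => diagP1 (k + 1) (k + 2 + e) t j) _
    (fun _ _ => diagP1_affine _ _ _ _) _ (by omega)

theorem deriv_deriv_rowRight_one (k e : ℕ) : deriv (deriv (rowRight k e)) 1 = 0 := by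
  have hv : ∀ j : ℕ, (e : ℝ) + (j + 1) + 3 = j + 1 + (e + 3) := fun j => by ring
  have key : HasDerivAt (fun t => ∑ j ∈ Finset.range (k + 3),
      ((k + 2).choose j : ℝ) ^ 2 * poch (e + j + 3) k * (rowP1 (k + 2) (k + 4 + e) t j *
        poch (t + (-j)) (k + 2)))
      ((∑ j ∈ Finset.range (k + 3), ((k + 2).choose j : ℝ) ^ 2 * poch (e + j + 3) k *
        (rowP1 (k + 2) (k + 4 + e) 1 j * poch (1 + (-j)) (k + 2))) *
        (S1 (k + 2) + S1 (k + 2) + ∑ i ∈ Finset.range (k + 4), (1 + (e : ℝ) + i)⁻¹)) 1 := by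
    obtain ⟨P, hP⟩ : ∃ P, P = rowP1 ((k : ℝ) + 2) (k + 4 + e) := ⟨_, rfl⟩
    have aff : ∀ t j, P t j = P 1 j + (t - 1) * (P 2 j - P 1 j) := by
      intro t j; rw [hP]; exact rowP1_affine _ _ _ _
    have quad : ∀ j, P 1 j = P 1 0 + (P 1 1 - P 1 (-1)) / 2 * j +
        ((P 1 1 + P 1 (-1)) / 2 - P 1 0) * j ^ 2 := by
      intro j; rw [hP]; exact rowP1_quadratic _ _ _
    have bdry := rowP1_boundary (k + 2) (k + 4 + e)
    rw [← hP] at bdry ⊢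
    have s := sum_alternating_quadratic_mul_poch k (show (0 : ℝ) < e + 3 by positivity)
      (P 1 0) ((P 1 1 - P 1 (-1)) / 2) ((P 1 1 + P 1 (-1)) / 2 - P 1 0)
    have d0 := (hasDerivAt_affine_mul_poch_zero (P 1 (0 : ℕ)) (P 2 (0 : ℕ) - P 1 (0 : ℕ))
      (k + 2)).const_mul
      (((k + 2).choose 0 : ℝ) ^ 2 * poch (e + (0 : ℕ) + 3) k)
    have ds := HasDerivAt.fun_sum (u := Finset.range (k + 2)) (x := (1 : ℝ)) fun j hj =>
      (hasDerivAt_affine_mul_poch_succ (P 1 (j + 1 : ℕ)) (P 2 (j + 1 : ℕ) - P 1 (j + 1 : ℕ))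
        (Finset.mem_range.1 hj)).const_mul
        (((k + 2).choose (j + 1) : ℝ) ^ 2 * poch (e + (j + 1 : ℕ) + 3) k)
    have hs : ∑ j ∈ Finset.range (k + 2), ((k + 2).choose (j + 1) : ℝ) ^ 2 *
        poch (e + (j + 1 : ℕ) + 3) k * (P 1 (j + 1 : ℕ) *
          ((-1) ^ j * j.factorial * (k + 2 - 1 - j).factorial)) =
        (k + 2).factorial * (poch (e + 3) k * (P 1 0 * S1 (k + 2) + (P 1 1 - P 1 (-1)) / 2 +
          P 1 0 * ∑ i ∈ Finset.range k, ((e : ℝ) + 3 + i)⁻¹)) := by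
      rw [← s, Finset.mul_sum]
      refine Finset.sum_congr rfl fun j hj => ?_
      have hf := choose_mul_factorial_div (Finset.mem_range.1 hj)
      rw [show k + 2 - 1 - j = k + 1 - j by omega] at hf ⊢
      push_cast
      rw [hv, quad (j + 1)]
      linear_combination (-1) ^ j * ((k + 2).choose (j + 1) : ℝ) * ((P 1 0 +
        (P 1 1 - P 1 (-1)) / 2 * (j + 1) + ((P 1 1 + P 1 (-1)) / 2 - P 1 0) * (j + 1) ^ 2) *
          poch (j + 1 + (e + 3)) k) * hf
    have hval : ∑ j ∈ Finset.range (k + 3), ((k + 2).choose j : ℝ) ^ 2 * poch (e + j + 3) k *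
        (P 1 j * poch (1 + (-j)) (k + 2)) = poch (e + 3) k * (P 1 0 * (k + 2).factorial) := by
      rw [Finset.sum_range_succ', Finset.sum_eq_zero]
      · simp [poch_one]
      · intro j hj
        rw [poch_one_sub_succ (Finset.mem_range.1 hj)]
        simp
    rw [hval]
    have hQ := ds.fun_add d0
    simp only [← aff] at hQ
    simp only [Finset.sum_range_succ' _ (k + 2)]
    refine hQ.congr_deriv ?_
    rw [hs, sum_inv_interval_row]
    simp only [Nat.choose_zero_right, Nat.cast_one, Nat.cast_zero, add_zero, one_pow, one_mul]
    have h1 : (1 : ℝ) + e ≠ 0 := by positivity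
    have h2 : (2 : ℝ) + e ≠ 0 := by positivity
    have h3 : (e : ℝ) + k + 3 ≠ 0 := by positivity
    have h4 : (e : ℝ) + k + 4 ≠ 0 := by positivity
    have b : P 2 0 - P 1 0 + (P 1 1 - P 1 (-1)) / 2 =
        P 1 0 * ((1 + e : ℝ)⁻¹ + (2 + e : ℝ)⁻¹ + (e + k + 3 : ℝ)⁻¹ + (e + k + 4 : ℝ)⁻¹) := by
      field_simp
      linear_combination 2 * bdry
    linear_combination ((k + 2).factorial : ℝ) * poch (e + 3) k * b
  have h := deriv_deriv_eq_zero_of_hasDerivAt (IsRationalDecay.sum (k := -1 + -((k + 2 : ℕ) : ℤ))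
    _ _ (by omega) fun j _ => IsRationalDecay.const_mul _
      (((isRationalDecay_affine _ _).congr fun t _ => rowP1_affine _ _ _ _).mul
        (IsRationalDecay.poch_add _ _))) ((k + 2).factorial : ℝ)⁻¹ (k + 2) (k + 2) (k + 4) e key
  have e1 : ((k + 2 : ℕ) : ℝ) + 1 = k + 3 := by push_cast; ring
  rw [e1, add_comm e (k + 4)] at h
  exact h

theorem deriv_deriv_diagRight_one (k e : ℕ) : deriv (deriv (diagRight k e)) 1 = 0 := by
  have hv : ∀ j : ℕ, (e : ℝ) + (j + 1) + 2 = j + 1 + (e + 2) := fun j => by ring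
  have key : HasDerivAt (fun t => ∑ j ∈ Finset.range (k + 3),
      ((k + 2).choose j : ℝ) ^ 2 * poch (e + j + 2) k * (diagP1 (k + 1) (k + 2 + e) t j *
        poch (t + (-j)) (k + 1)))
      ((∑ j ∈ Finset.range (k + 3), ((k + 2).choose j : ℝ) ^ 2 * poch (e + j + 2) k *
        (diagP1 (k + 1) (k + 2 + e) 1 j * poch (1 + (-j)) (k + 1))) *
        (S1 (k + 1) + S1 (k + 2) + ∑ i ∈ Finset.range (k + 2), (1 + (e : ℝ) + i)⁻¹)) 1 := by
    obtain ⟨P, hP⟩ : ∃ P, P = diagP1 ((k : ℝ) + 1) (k + 2 + e) := ⟨_, rfl⟩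
    obtain ⟨α, hα⟩ : ∃ α, α = diagIntercept ((k : ℝ) + 1) (k + 2 + e) := ⟨_, rfl⟩
    obtain ⟨β, hβ⟩ : ∃ β, β = diagSlope ((k : ℝ) + 1) (k + 2 + e) := ⟨_, rfl⟩
    have aff : ∀ t j, P t j = P 1 j + (t - 1) * (P 2 j - P 1 j) := by
      intro t j; rw [hP]; exact diagP1_affine _ _ _ _
    have fac : ∀ j, P 1 j = (k + 2 - j) * (α + β * j) := by
      intro j; rw [hP, hα, hβ, diagP1_factor]; ring
    have last : P 2 (k + 2 : ℕ) - P 1 (k + 2 : ℕ) = α + β * (k + 2) := by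
      have h := diagP1_last (k + 1) (k + 2 + e)
      rw [← hP, ← hα, ← hβ] at h
      push_cast
      linear_combination (norm := ring_nf) h
    have bdry := diagP1_boundary (k + 1) (k + 2 + e)
    rw [← hP, ← hβ] at bdry
    rw [← hP]
    have s := sum_alternating_quadratic_mul_poch k (show (0 : ℝ) < e + 2 by positivity) α β 0
    have d0 := (hasDerivAt_affine_mul_poch_zero (P 1 (0 : ℕ)) (P 2 (0 : ℕ) - P 1 (0 : ℕ))
      (k + 1)).const_mul (((k + 2).choose 0 : ℝ) ^ 2 * poch (e + (0 : ℕ) + 2) k)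
    have ds := HasDerivAt.fun_sum (u := Finset.range (k + 1)) (x := (1 : ℝ)) fun j hj =>
      (hasDerivAt_affine_mul_poch_succ (P 1 (j + 1 : ℕ)) (P 2 (j + 1 : ℕ) - P 1 (j + 1 : ℕ))
        (Finset.mem_range.1 hj)).const_mul
        (((k + 2).choose (j + 1) : ℝ) ^ 2 * poch (e + (j + 1 : ℕ) + 2) k)
    have dl := (hasDerivAt_mul_poch_self (P 2 (k + 2 : ℕ) - P 1 (k + 2 : ℕ)) (k + 1)).const_mul
      (((k + 2).choose (k + 2) : ℝ) ^ 2 * poch (e + (k + 2 : ℕ) + 2) k)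
    have P_last : P 1 (k + 2 : ℕ) = 0 := by rw [fac]; push_cast; ring
    rw [← P_last] at dl
    have hs : ∑ j ∈ Finset.range (k + 1), ((k + 2).choose (j + 1) : ℝ) ^ 2 *
        poch (e + (j + 1 : ℕ) + 2) k * (P 1 (j + 1 : ℕ) *
          ((-1) ^ j * j.factorial * (k + 1 - 1 - j).factorial)) +
        ((k + 2).choose (k + 2) : ℝ) ^ 2 * poch (e + (k + 2 : ℕ) + 2) k *
          ((P 2 (k + 2 : ℕ) - P 1 (k + 2 : ℕ)) * ((-1) ^ (k + 1) * (k + 1).factorial)) =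
        (k + 2).factorial * (poch (e + 2) k * (α * S1 (k + 2) + β +
          α * ∑ i ∈ Finset.range k, ((e : ℝ) + 2 + i)⁻¹)) := by
      rw [← s, Finset.sum_range_succ _ (k + 1), mul_add, Finset.mul_sum]
      congr 1
      · refine Finset.sum_congr rfl fun j hj => ?_
        have hj' := Finset.mem_range.1 hj
        have hf := choose_mul_factorial_div (show j < k + 2 by omega)
        have hg : ((k + 2 - 1 - j).factorial : ℝ) =
            (k + 2 - (j + 1)) * (k + 1 - 1 - j).factorial := by
          rw [show k + 2 - 1 - j = k + 1 - 1 - j + 1 by omega, Nat.factorial_succ,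
            show k + 1 - 1 - j + 1 = k + 1 - j by omega, Nat.cast_mul, Nat.cast_sub (by omega)]
          push_cast
          ring
        rw [hg] at hf
        rw [show k + 1 - 1 - j = k - j by omega] at hf ⊢
        push_cast
        rw [hv, fac (j + 1)]
        linear_combination (-1) ^ j * ((k + 2).choose (j + 1) : ℝ) *
          ((α + β * (j + 1)) * poch (j + 1 + (e + 2)) k) * hf
      · rw [last, factorial_cast_succ (k + 1), show k + 1 + 1 = k + 2 by rfl, Nat.choose_self]
        have : (k : ℝ) + 2 ≠ 0 := by positivity
        push_cast
        rw [show (k : ℝ) + 1 + 1 = k + 2 by ring, show (e : ℝ) + (k + 2) + 2 = k + 2 + (e + 2) by ring]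
        field_simp
        ring
    have hval : ∑ j ∈ Finset.range (k + 3), ((k + 2).choose j : ℝ) ^ 2 * poch (e + j + 2) k *
        (P 1 j * poch (1 + (-j)) (k + 1)) = poch (e + 2) k * (P 1 0 * (k + 1).factorial) := by
      rw [Finset.sum_range_succ', Finset.sum_range_succ, Finset.sum_eq_zero, P_last]
      · simp [poch_one]
      · intro j hj
        rw [poch_one_sub_succ (Finset.mem_range.1 hj)]
        simp
    rw [hval]
    have hQ := (ds.fun_add dl).fun_add d0
    simp only [← aff] at hQ
    have e0 : ∀ f : ℕ → ℝ, ∑ j ∈ Finset.range (k + 3), f j =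
        ∑ j ∈ Finset.range (k + 1), f (j + 1) + f (k + 2) + f 0 := by
      intro f
      rw [Finset.sum_range_succ', Finset.sum_range_succ]
    simp only [e0]
    refine hQ.congr_deriv ?_
    rw [hs, sum_inv_interval_diag, factorial_cast_succ (k + 1)]
    simp only [Nat.choose_zero_right, Nat.cast_one, Nat.cast_zero, add_zero, one_pow, one_mul]
    have h1 : (1 : ℝ) + e ≠ 0 := by positivity
    have h2 : (e : ℝ) + k + 2 ≠ 0 := by positivity
    have fac0 := fac 0
    have b : P 2 0 - P 1 0 + (k + 2) * β = P 1 0 * ((1 + e : ℝ)⁻¹ + (e + k + 2 : ℝ)⁻¹) := by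
      field_simp
      linear_combination bdry
    push_cast
    linear_combination ((k + 1).factorial : ℝ) * poch (e + 2) k *
      (b - (S1 (k + 2) + ∑ i ∈ Finset.range k, ((e : ℝ) + 2 + i)⁻¹) * fac0)
  have h := deriv_deriv_eq_zero_of_hasDerivAt (IsRationalDecay.sum (k := -1 + -((k + 1 : ℕ) : ℤ))
    _ _ (by omega) fun j _ => IsRationalDecay.const_mul _
      (((isRationalDecay_affine _ _).congr fun t _ => diagP1_affine _ _ _ _).mul
        (IsRationalDecay.poch_add _ _))) (((k + 2).factorial : ℝ) * (k + 2))⁻¹ (k + 1) (k + 2)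
        (k + 2) e key
  have e1 : ((k + 1 : ℕ) : ℝ) + 1 = k + 2 := by push_cast; ring
  rw [e1, add_comm e (k + 2)] at h
  exact h

theorem Zr_eq_tsum {n m a : ℕ} (h : m + a = n) :
    Zr n m = 1 / 6 * ∑' ν : ℕ, deriv (deriv (rightR n a)) (1 + (ν : ℝ)) := by
  rw [Zr, funext (Rtilde_eq_rightR h)]

theorem tsum_deriv_deriv_of_telescope {f₀ f₁ f₂ C : ℝ → ℝ} {c₀ c₁ c₂ : ℝ}
    (h₀ : IsRationalDecay f₀ 2) (h₁ : IsRationalDecay f₁ 2) (h₂ : IsRationalDecay f₂ 2)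
    (hC : IsRationalDecay C 0) (hC1 : deriv (deriv C) 1 = 0)
    (h : ∀ t : ℝ, 0 < t → c₀ * f₀ t + c₁ * f₁ t + c₂ * f₂ t = C (t + 1) - C t) :
    c₀ * ∑' ν : ℕ, deriv (deriv f₀) (1 + ν) + c₁ * ∑' ν : ℕ, deriv (deriv f₁) (1 + ν) +
      c₂ * ∑' ν : ℕ, deriv (deriv f₂) (1 + ν) = 0 := by
  have h' := deriv_combination_of_telescope h₀ h₁ h₂ hC h
  have h'' := deriv_combination_of_telescope h₀.deriv h₁.deriv h₂.deriv hC.deriv h'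
  rw [tsum_combination_of_telescope (h₀.deriv.deriv.mono (by norm_num))
    (h₁.deriv.deriv.mono (by norm_num)) (h₂.deriv.deriv.mono (by norm_num))
    (hC.deriv.deriv.mono (by norm_num)) h'' one_pos, hC1, neg_zero]

theorem Zr_diag {n m b : ℕ} (h : m + b + 2 = 2 * n) (hb : n ≤ b + 1) :
    diagC0 n (b + 2) * Zr n m + diagC1 n (b + 2) * Zr n (m + 1) +
      diagC2 n (b + 2) * Zr (n + 1) (m + 2) = 0 := by
  obtain ⟨k, rfl⟩ : ∃ k, n = k + 1 := ⟨n - 1, by omega⟩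
  obtain ⟨e, rfl⟩ : ∃ e, b = k + e := ⟨b - k, by omega⟩
  have key := tsum_deriv_deriv_of_telescope (rightR_decay (k + 1) (e + 1))
    (rightR_decay (k + 1) e) (rightR_decay (k + 2) e) (diagRight_decay k e)
    (deriv_deriv_diagRight_one k e) fun t ht => diagRight_telescope k e ht
  rw [Zr_eq_tsum (a := e + 1) (by omega), Zr_eq_tsum (a := e) (by omega),
    Zr_eq_tsum (a := e) (by omega)]
  have hN : ((k + e : ℕ) : ℝ) + 2 = k + 2 + e := by push_cast; ring
  have hn : ((k + 1 : ℕ) : ℝ) = k + 1 := by push_cast; ring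
  rw [hN, hn]
  linear_combination 1 / 6 * key

theorem Zr_row {n m b : ℕ} (h : m + b + 2 = 2 * n) (hb : n ≤ b) :
    rowC0 n (b + 2) * Zr n m + rowC1 n (b + 2) * Zr n (m + 1) +
      rowC2 n (b + 2) * Zr n (m + 2) = 0 := by
  obtain ⟨k, rfl⟩ : ∃ k, n = k + 2 := ⟨n - 2, by omega⟩
  obtain ⟨e, rfl⟩ : ∃ e, b = k + 2 + e := ⟨b - (k + 2), by omega⟩
  have key := tsum_deriv_deriv_of_telescope (rightR_decay (k + 2) (e + 2))
    (rightR_decay (k + 2) (e + 1)) (rightR_decay (k + 2) e) (rowRight_decay k e)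
    (deriv_deriv_rowRight_one k e) fun t ht => rowRight_telescope k e ht
  rw [Zr_eq_tsum (a := e + 2) (by omega), Zr_eq_tsum (a := e + 1) (by omega),
    Zr_eq_tsum (a := e) (by omega)]
  have hN : ((k + 2 + e : ℕ) : ℝ) + 2 = k + 4 + e := by push_cast; ring
  have hn : ((k + 2 : ℕ) : ℝ) = k + 2 := by push_cast; ring
  rw [hN, hn]
  linear_combination 1 / 6 * key

theorem hasDerivAt_inv_pow {c t : ℝ} (h : t + c ≠ 0) (i : ℕ) :
    HasDerivAt (fun s => (s + c)⁻¹ ^ i) (-(i * (t + c)⁻¹ ^ (i + 1))) t := by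
  cases i with
  | zero => simpa using hasDerivAt_const t (1 : ℝ)
  | succ i =>
    refine ((((hasDerivAt_id' t).add_const c).fun_inv h).fun_pow (i + 1)).congr_deriv ?_
    simp only [Nat.add_sub_cancel, neg_div, one_div, ← inv_pow]
    ring

theorem isRationalDecay_inv_pow {c : ℝ} (hc : 0 ≤ c) (i : ℕ) :
    IsRationalDecay (fun s => (s + c)⁻¹ ^ i) i :=
  ((IsRationalDecay.inv_add_const hc).pow i).mono (by simp)

theorem tsum_deriv_R_sub_Zr_of_telescope {n m : ℕ} (hmn : m ≤ n) {G : ℝ → ℝ}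
    (hG : IsRationalDecay G 0)
    (h : ∀ t : ℝ, 0 < t → -(1 / 3) * R n m t - 1 / 6 * deriv (Rtilde n m) t = G (t + 1) - G t) :
    -(1 / 3) * ∑' ν : ℕ, deriv (R n m) (1 + ν) - Zr n m = -deriv G 1 := by
  have h₀ := (R_decay hmn).mono (show (2 : ℤ) ≤ 3 by norm_num)
  have h₁ := (Rtilde_decay hmn).deriv.mono (show (2 : ℤ) ≤ 2 + 1 by norm_num)
  have key := tsum_combination_of_telescope (h₀.deriv.mono (by norm_num))
    (h₁.deriv.mono (by norm_num)) (h₁.deriv.mono (by norm_num)) hG.deriv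
    (deriv_combination_of_telescope (c₀ := -(1 / 3)) (c₁ := -(1 / 6)) (c₂ := 0) h₀ h₁ h₁ hG
      fun t ht => by rw [← h t ht]; ring) one_pos
  rw [← key, Zr]
  ring

theorem tsum_deriv_R {n m : ℕ} (hmn : m ≤ n) :
    ∑' ν : ℕ, deriv (R n m) (1 + ν) = deriv (R n m) 1 + ∑' ν : ℕ, deriv (R n m) (2 + ν) := by
  have hs := ((R_decay hmn).deriv.mono (show (2 : ℤ) ≤ 3 + 1 by norm_num)).summable 1
  rw [hs.tsum_eq_zero_add]
  congr 2
  · simp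
  · ext ν
    congr 1
    push_cast
    ring

theorem hasDerivAt_of_eq_pos {f g : ℝ → ℝ} {g' t : ℝ} (ht : 0 < t) (h : ∀ s : ℝ, 0 < s → f s = g s)
    (hg : HasDerivAt g g' t) : HasDerivAt f g' t :=
  hg.congr_of_eventuallyEq <| by filter_upwards [lt_mem_nhds ht] with s hs using h s hs

theorem Zl_eq_Zr_zero_zero : Zl 0 0 = Zr 0 0 := by
  have h := tsum_deriv_R_sub_Zr_of_telescope (n := 0) le_rfl (G := fun _ => 0)
    (IsRationalDecay.const 0) fun t ht => by
      have hd : HasDerivAt (Rtilde 0 0) _ t :=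
        hasDerivAt_of_eq_pos ht (g := fun s => (s + 0)⁻¹ ^ 2)
          (fun s hs => by simp [Rtilde, poch]; field_simp)
          (hasDerivAt_inv_pow (by simpa using ht.ne') 2)
      rw [hd.deriv]
      simp [R, poch]
      field_simp
      norm_num
  simp only [deriv_const, neg_zero] at h
  rw [← sub_eq_zero, ← h, Zl]
  simp

theorem Zl_eq_Zr_one_one : Zl 1 1 = Zr 1 1 := by
  have h := tsum_deriv_R_sub_Zr_of_telescope (n := 1) le_rfl
    (G := fun s => -(2 / 3) * (s + 0)⁻¹ ^ 4 + 4 / 3 * (s + 0)⁻¹ ^ 3 + -(2 / 3) * (s + 0)⁻¹ ^ 2)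
    (((((isRationalDecay_inv_pow le_rfl 4).const_mul _).mono (by norm_num)).add
      (((isRationalDecay_inv_pow le_rfl 3).const_mul _).mono (by norm_num))).add
      (((isRationalDecay_inv_pow le_rfl 2).const_mul _).mono (by norm_num))) fun t ht => by
      have h0 : t + 0 ≠ 0 := by positivity
      have h1 : t + 1 ≠ 0 := by positivity
      have hd : HasDerivAt (Rtilde 1 1) _ t :=
        hasDerivAt_of_eq_pos ht (g := fun s => 2 * (s + 0)⁻¹ ^ 2 + -9 * (s + 0)⁻¹ ^ 1 +
          10 * (s + 1)⁻¹ ^ 2 + 9 * (s + 1)⁻¹ ^ 1)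
          (fun s hs => by
            simp [Rtilde, poch, Finset.sum_range_succ, Finset.prod_range_succ]
            field_simp
            ring)
          (((((hasDerivAt_inv_pow h0 2).const_mul 2).fun_add
            ((hasDerivAt_inv_pow h0 1).const_mul (-9))).fun_add
            ((hasDerivAt_inv_pow h1 2).const_mul 10)).fun_add
            ((hasDerivAt_inv_pow h1 1).const_mul 9))
      rw [hd.deriv]
      simp [R, poch, Finset.prod_range_succ]
      field_simp
      ring
  have h0 : (1 : ℝ) + 0 ≠ 0 := by norm_num
  rw [((((hasDerivAt_inv_pow h0 4).const_mul _).fun_add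
    ((hasDerivAt_inv_pow h0 3).const_mul _)).fun_add
    ((hasDerivAt_inv_pow h0 2).const_mul _)).deriv] at h
  refine sub_eq_zero.1 (Eq.trans ?_ (h.trans (by norm_num)))
  simp [Zl]

theorem Zl_eq_Zr_one_zero : Zl 1 0 = Zr 1 0 := by
  have h := tsum_deriv_R_sub_Zr_of_telescope (n := 1) (m := 0) (by norm_num)
    (G := fun s => 1 * (s + 0)⁻¹ ^ 4 + -(8 / 3) * (s + 0)⁻¹ ^ 3 + 5 / 2 * (s + 0)⁻¹ ^ 2 +
      -(13 / 4) * (s + 1)⁻¹ ^ 2)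
    ((((((isRationalDecay_inv_pow le_rfl 4).const_mul _).mono (by norm_num)).add
      (((isRationalDecay_inv_pow le_rfl 3).const_mul _).mono (by norm_num))).add
      (((isRationalDecay_inv_pow le_rfl 2).const_mul _).mono (by norm_num))).add
      (((isRationalDecay_inv_pow zero_le_one 2).const_mul _).mono (by norm_num))) fun t ht => by
      have h0 : t + 0 ≠ 0 := by positivity
      have h1 : t + 1 ≠ 0 := by positivity
      have h2 : t + 2 ≠ 0 := by positivity
      have hd : HasDerivAt (Rtilde 1 0) _ t :=
        hasDerivAt_of_eq_pos ht (g := fun s => 3 / 2 * (s + 0)⁻¹ ^ 1 + -16 * (s + 1)⁻¹ ^ 2 +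
          18 * (s + 1)⁻¹ ^ 1 + -(39 / 2) * (s + 2)⁻¹ ^ 1)
          (fun s hs => by
            simp [Rtilde, poch, Finset.sum_range_succ, Finset.prod_range_succ]
            field_simp
            ring)
          (((((hasDerivAt_inv_pow h0 1).const_mul _).fun_add
            ((hasDerivAt_inv_pow h1 2).const_mul _)).fun_add
            ((hasDerivAt_inv_pow h1 1).const_mul _)).fun_add
            ((hasDerivAt_inv_pow h2 1).const_mul _))
      have h3 : t + 1 + 1 ≠ 0 := by positivity
      rw [hd.deriv]
      simp [R, poch, Finset.prod_range_succ]
      field_simp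
      ring
  have h0 : (1 : ℝ) + 0 ≠ 0 := by norm_num
  have h1 : (1 : ℝ) + 1 ≠ 0 := by norm_num
  have hR : HasDerivAt (R 1 0) _ 1 :=
    hasDerivAt_of_eq_pos one_pos (g := fun s => 3 * (s + 0)⁻¹ ^ 4 + -8 * (s + 0)⁻¹ ^ 3 +
      33 / 4 * (s + 0)⁻¹ ^ 2 + -3 * (s + 1)⁻¹ ^ 4 + -8 * (s + 1)⁻¹ ^ 3 +
      -(33 / 4) * (s + 1)⁻¹ ^ 2)
      (fun s hs => by
        simp [R, poch, Finset.prod_range_succ]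
        field_simp
        ring)
      (((((((hasDerivAt_inv_pow h0 4).const_mul _).fun_add
        ((hasDerivAt_inv_pow h0 3).const_mul _)).fun_add
        ((hasDerivAt_inv_pow h0 2).const_mul _)).fun_add
        ((hasDerivAt_inv_pow h1 4).const_mul _)).fun_add
        ((hasDerivAt_inv_pow h1 3).const_mul _)).fun_add
        ((hasDerivAt_inv_pow h1 2).const_mul _))
  rw [(((((hasDerivAt_inv_pow h0 4).const_mul _).fun_add
    ((hasDerivAt_inv_pow h0 3).const_mul _)).fun_add
    ((hasDerivAt_inv_pow h0 2).const_mul _)).fun_add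
    ((hasDerivAt_inv_pow h1 2).const_mul _)).deriv, tsum_deriv_R (by norm_num), hR.deriv] at h
  have hZ : Zl 1 0 = -(1 / 3) * ∑' ν : ℕ, deriv (R 1 0) (2 + ν) := by
    rw [Zl]
    norm_num
  rw [hZ]
  norm_num at h
  linarith

theorem Zl_eq_Zr_two_one : Zl 2 1 = Zr 2 1 := by
  have h := tsum_deriv_R_sub_Zr_of_telescope (n := 2) (m := 1) (by norm_num)
    (G := fun s => -40 * (s + 0)⁻¹ ^ 4 + 252 * (s + 0)⁻¹ ^ 3 + -(15059 / 18) * (s + 0)⁻¹ ^ 2 +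
      1996 * (s + 0)⁻¹ ^ 1 + -40 * (s + 1)⁻¹ ^ 4 + -792 * (s + 1)⁻¹ ^ 3 +
      -(9226 / 9) * (s + 1)⁻¹ ^ 2 + -1996 * (s + 1)⁻¹ ^ 1 + -(1265 / 9) * (s + 2)⁻¹ ^ 2)
    (((((((((((isRationalDecay_inv_pow le_rfl 4).const_mul _).mono (by norm_num)).add
      (((isRationalDecay_inv_pow le_rfl 3).const_mul _).mono (by norm_num))).add
      (((isRationalDecay_inv_pow le_rfl 2).const_mul _).mono (by norm_num))).add
      (((isRationalDecay_inv_pow le_rfl 1).const_mul _).mono (by norm_num))).add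
      (((isRationalDecay_inv_pow zero_le_one 4).const_mul _).mono (by norm_num))).add
      (((isRationalDecay_inv_pow zero_le_one 3).const_mul _).mono (by norm_num))).add
      (((isRationalDecay_inv_pow zero_le_one 2).const_mul _).mono (by norm_num))).add
      (((isRationalDecay_inv_pow zero_le_one 1).const_mul _).mono (by norm_num))).add
      (((isRationalDecay_inv_pow zero_le_two 2).const_mul _).mono (by norm_num))) fun t ht => by
      have h0 : t + 0 ≠ 0 := by positivity
      have h1 : t + 1 ≠ 0 := by positivity
      have h2 : t + 2 ≠ 0 := by positivity
      have h3 : t + 3 ≠ 0 := by positivity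
      have hd : HasDerivAt (Rtilde 2 1) _ t :=
        hasDerivAt_of_eq_pos ht (g := fun s => 10 / 3 * (s + 0)⁻¹ ^ 1 + -324 * (s + 1)⁻¹ ^ 2 +
          1131 * (s + 1)⁻¹ ^ 1 + -1620 * (s + 2)⁻¹ ^ 2 + -291 * (s + 2)⁻¹ ^ 1 +
          -(2530 / 3) * (s + 3)⁻¹ ^ 1)
          (fun s hs => by
            simp [Rtilde, poch, Finset.sum_range_succ, Finset.prod_range_succ]
            norm_num [Nat.choose, Nat.factorial]
            field_simp
            ring)
          (((((((hasDerivAt_inv_pow h0 1).const_mul _).fun_add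
            ((hasDerivAt_inv_pow h1 2).const_mul _)).fun_add
            ((hasDerivAt_inv_pow h1 1).const_mul _)).fun_add
            ((hasDerivAt_inv_pow h2 2).const_mul _)).fun_add
            ((hasDerivAt_inv_pow h2 1).const_mul _)).fun_add
            ((hasDerivAt_inv_pow h3 1).const_mul _))
      have h4 : t + 1 + 1 ≠ 0 := by positivity
      have h5 : t + 1 + 2 ≠ 0 := by positivity
      rw [hd.deriv]
      simp [R, poch, Finset.prod_range_succ]
      norm_num [Nat.factorial]
      field_simp
      ring
  have h0 : (1 : ℝ) + 0 ≠ 0 := by norm_num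
  have h1 : (1 : ℝ) + 1 ≠ 0 := by norm_num
  have h2 : (1 : ℝ) + 2 ≠ 0 := by norm_num
  have hR : HasDerivAt (R 2 1) _ 1 :=
    hasDerivAt_of_eq_pos one_pos (g := fun s => -120 * (s + 0)⁻¹ ^ 4 + 756 * (s + 0)⁻¹ ^ 3 +
      -(15049 / 6) * (s + 0)⁻¹ ^ 2 + 5988 * (s + 0)⁻¹ ^ 1 + -3456 * (s + 1)⁻¹ ^ 3 +
      -11976 * (s + 1)⁻¹ ^ 1 + 120 * (s + 2)⁻¹ ^ 4 + 756 * (s + 2)⁻¹ ^ 3 +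
      15049 / 6 * (s + 2)⁻¹ ^ 2 + 5988 * (s + 2)⁻¹ ^ 1)
      (fun s hs => by
        simp [R, poch, Finset.prod_range_succ]
        norm_num [Nat.factorial]
        field_simp
        ring)
      (((((((((((hasDerivAt_inv_pow h0 4).const_mul _).fun_add
        ((hasDerivAt_inv_pow h0 3).const_mul _)).fun_add
        ((hasDerivAt_inv_pow h0 2).const_mul _)).fun_add
        ((hasDerivAt_inv_pow h0 1).const_mul _)).fun_add
        ((hasDerivAt_inv_pow h1 3).const_mul _)).fun_add
        ((hasDerivAt_inv_pow h1 1).const_mul _)).fun_add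
        ((hasDerivAt_inv_pow h2 4).const_mul _)).fun_add
        ((hasDerivAt_inv_pow h2 3).const_mul _)).fun_add
        ((hasDerivAt_inv_pow h2 2).const_mul _)).fun_add
        ((hasDerivAt_inv_pow h2 1).const_mul _))
  rw [((((((((((hasDerivAt_inv_pow h0 4).const_mul _).fun_add
    ((hasDerivAt_inv_pow h0 3).const_mul _)).fun_add
    ((hasDerivAt_inv_pow h0 2).const_mul _)).fun_add
    ((hasDerivAt_inv_pow h0 1).const_mul _)).fun_add
    ((hasDerivAt_inv_pow h1 4).const_mul _)).fun_add
    ((hasDerivAt_inv_pow h1 3).const_mul _)).fun_add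
    ((hasDerivAt_inv_pow h1 2).const_mul _)).fun_add
    ((hasDerivAt_inv_pow h1 1).const_mul _)).fun_add
    ((hasDerivAt_inv_pow h2 2).const_mul _)).deriv, tsum_deriv_R (by norm_num), hR.deriv] at h
  have hZ : Zl 2 1 = -(1 / 3) * ∑' ν : ℕ, deriv (R 2 1) (2 + ν) := by
    rw [Zl]
    norm_num
  rw [hZ]
  norm_num at h
  linarith

theorem Zl_eq_Zr_of_diag {n m : ℕ} (hm : m + 1 ≤ n) (h₀ : Zl n m = Zr n m)
    (h₁ : Zl n (m + 1) = Zr n (m + 1)) : Zl (n + 1) (m + 2) = Zr (n + 1) (m + 2) := by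
  obtain ⟨b, hb⟩ : ∃ b, m + b + 2 = 2 * n := ⟨2 * n - m - 2, by omega⟩
  have hb' : (m : ℝ) + b + 2 = 2 * n := by exact_mod_cast hb
  have hl := Zl_diag hb (by omega)
  have hr := Zr_diag hb (by omega)
  rw [h₀, h₁] at hl
  have hc : diagC2 n (b + 2) ≠ 0 := by
    rw [diagC2, show 2 * (n : ℝ) + 2 - (b + 2) = m + 2 by linarith]
    positivity
  exact mul_left_cancel₀ hc (by linear_combination hl - hr)

theorem Zl_eq_Zr_of_row {n m : ℕ} (hm : m + 2 ≤ n) (h₁ : Zl n (m + 1) = Zr n (m + 1))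
    (h₂ : Zl n (m + 2) = Zr n (m + 2)) : Zl n m = Zr n m := by
  obtain ⟨b, hb⟩ : ∃ b, m + b + 2 = 2 * n := ⟨2 * n - m - 2, by omega⟩
  have hl := Zl_row hb (by omega)
  have hr := Zr_row hb (by omega)
  rw [h₁, h₂] at hl
  have hc : rowC0 n (b + 2) ≠ 0 := by
    rw [rowC0]
    positivity
  exact mul_left_cancel₀ hc (by linear_combination hl - hr)

/-- Theorem 1 of the paper: for all integers `n ≥ m ≥ 0`, `Z_l(n,m) = Z_r(n,m)`. -/
theorem zeta4_identity (n m : ℕ) (hmn : m ≤ n) : Zl n m = Zr n m := by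
  induction n generalizing m with
  | zero =>
    obtain rfl : m = 0 := by omega
    exact Zl_eq_Zr_zero_zero
  | succ n ih =>
    have two_add : ∀ m, m + 1 ≤ n → Zl (n + 1) (m + 2) = Zr (n + 1) (m + 2) := fun m hm =>
      Zl_eq_Zr_of_diag hm (ih m (by omega)) (ih (m + 1) hm)
    have one : Zl (n + 1) 1 = Zr (n + 1) 1 := by
      rcases n with _ | _ | n
      · exact Zl_eq_Zr_one_one
      · exact Zl_eq_Zr_two_one
      · exact Zl_eq_Zr_of_row (by omega) (two_add 0 (by omega)) (two_add 1 (by omega))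
    rcases m with _ | _ | m
    · rcases n with _ | n
      · exact Zl_eq_Zr_one_zero
      · exact Zl_eq_Zr_of_row (by omega) one (two_add 0 (by omega))
    · exact one
    · exact two_add m (by omega)
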